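/- Let A be a smooth affine free finite idempotent algebra omitting type 1. Then any two maximal elements a,b of A are connected by a path a = c_1, c_2, ..., c_k = b in which every c_i is a maximal element of A, every consecutive pair c_i c_{i+1} is either a thin semilattice edge or an undirected thin majority edge, and at most one consecutive pair is an undirected thin majority edge. -/

import Mathlib

/-! Common framework: universal algebras over a fixed signature, terms,
subalgebras, congruences, quotients, edges and their types (Bulatov's
coloured-graph approach), thin edges, connectivity, products, etc. -/

/-- A (functional) signature: a type of operation symbols with arities. -/
structure Signature where
  ops : Type
  arity : ops → ℕ

/-- An algebra of a given signature. -/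
structure UAlgebra (σ : Signature) where
  carrier : Type
  interp : ∀ f : σ.ops, (Fin (σ.arity f) → carrier) → carrier

/-- Terms over the signature `σ` in `n` variables. -/
inductive Term (σ : Signature) (n : ℕ) where
  | var : Fin n → Term σ n
  | app : (f : σ.ops) → (Fin (σ.arity f) → Term σ n) → Term σ n

/-- Evaluation of a term in an algebra; term operations of an algebra are
exactly the operations of the form `Term.eval A t`. -/
def Term.eval {σ : Signature} {n : ℕ} (A : UAlgebra σ) :
    Term σ n → (Fin n → A.carrier) → A.carrier
  | .var i, x => x i
  | .app f ts, x => A.interp f fun j => Term.eval A (ts j) x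

namespace UAlgebra

variable {σ : Signature}

/-- An algebra is idempotent if all its basic operations are. -/
def Idempotent (A : UAlgebra σ) : Prop :=
  ∀ (f : σ.ops) (a : A.carrier), A.interp f (fun _ => a) = a

/-- A set closed under all basic operations. -/
def IsClosed (A : UAlgebra σ) (S : Set A.carrier) : Prop :=
  ∀ (f : σ.ops) (x : Fin (σ.arity f) → A.carrier), (∀ j, x j ∈ S) → A.interp f x ∈ S

/-- Closure of a set under the basic operations. -/
inductive Closure (A : UAlgebra σ) (S : Set A.carrier) : A.carrier → Prop
  | base {a : A.carrier} : a ∈ S → Closure A S a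
  | app (f : σ.ops) (x : Fin (σ.arity f) → A.carrier) :
      (∀ j, Closure A S (x j)) → Closure A S (A.interp f x)

def ClosureSet (A : UAlgebra σ) (S : Set A.carrier) : Set A.carrier := {x | Closure A S x}

theorem closureSet_isClosed (A : UAlgebra σ) (S : Set A.carrier) :
    A.IsClosed (A.ClosureSet S) := fun f x h => Closure.app f x h

/-- The subalgebra of `A` on a closed subset `S`. -/
def subalg (A : UAlgebra σ) (S : Set A.carrier) (hS : A.IsClosed S) : UAlgebra σ where
  carrier := {x : A.carrier // x ∈ S}
  interp f x := ⟨A.interp f fun j => (x j : A.carrier), hS f _ fun j => (x j).2⟩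

/-- The subalgebra generated by a set `S`. -/
def Sg (A : UAlgebra σ) (S : Set A.carrier) : UAlgebra σ :=
  A.subalg (A.ClosureSet S) (A.closureSet_isClosed S)

/-- `a` as an element of `Sg {a, b}`. -/
def sgA (A : UAlgebra σ) (a b : A.carrier) : (A.Sg {a, b}).carrier :=
  ⟨a, Closure.base (Set.mem_insert a {b})⟩

/-- `b` as an element of `Sg {a, b}`. -/
def sgB (A : UAlgebra σ) (a b : A.carrier) : (A.Sg {a, b}).carrier :=
  ⟨b, Closure.base (Set.mem_insert_iff.mpr (Or.inr rfl))⟩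

/-- A congruence of an algebra. -/
structure Congruence (A : UAlgebra σ) where
  rel : A.carrier → A.carrier → Prop
  refl : ∀ x, rel x x
  symm : ∀ {x y}, rel x y → rel y x
  trans : ∀ {x y z}, rel x y → rel y z → rel x z
  compat : ∀ (f : σ.ops) (x y : Fin (σ.arity f) → A.carrier),
      (∀ j, rel (x j) (y j)) → rel (A.interp f x) (A.interp f y)

def Congruence.toSetoid {A : UAlgebra σ} (θ : Congruence A) : Setoid A.carrier :=
  ⟨θ.rel, ⟨θ.refl, θ.symm, θ.trans⟩⟩

/-- The full congruence. -/
def Congruence.IsFull {A : UAlgebra σ} (θ : Congruence A) : Prop := ∀ x y, θ.rel x y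

def Congruence.le {A : UAlgebra σ} (θ η : Congruence A) : Prop :=
  ∀ x y, θ.rel x y → η.rel x y

/-- A maximal congruence: proper, and any congruence above it is full or below it. -/
def Congruence.IsMaximal {A : UAlgebra σ} (θ : Congruence A) : Prop :=
  ¬ θ.IsFull ∧ ∀ η : Congruence A, θ.le η → ¬ η.IsFull → η.le θ

/-- The quotient (factor) algebra. -/
noncomputable def quot (A : UAlgebra σ) (θ : Congruence A) : UAlgebra σ where
  carrier := Quotient θ.toSetoid
  interp f x := Quotient.mk θ.toSetoid (A.interp f fun j => (x j).out)

/-- The class of `a` in the quotient of `Sg {a,b}` by `θ`. -/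
def qa (A : UAlgebra σ) (a b : A.carrier) (θ : Congruence (A.Sg {a, b})) :
    ((A.Sg {a, b}).quot θ).carrier :=
  Quotient.mk θ.toSetoid (A.sgA a b)

def qb (A : UAlgebra σ) (a b : A.carrier) (θ : Congruence (A.Sg {a, b})) :
    ((A.Sg {a, b}).quot θ).carrier :=
  Quotient.mk θ.toSetoid (A.sgB a b)

end UAlgebra

/-- A binary operation is a semilattice operation on a set `B`. -/
def IsSemilatticeOn {α : Type} (f : α → α → α) (B : Set α) : Prop :=
  (∀ x ∈ B, f x x = x) ∧ (∀ x ∈ B, ∀ y ∈ B, f x y = f y x) ∧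
    (∀ x ∈ B, ∀ y ∈ B, ∀ z ∈ B, f x (f y z) = f (f x y) z)

/-- A ternary operation is a majority operation on a set `B`. -/
def IsMajorityOn {α : Type} (g : α → α → α → α) (B : Set α) : Prop :=
  ∀ x ∈ B, ∀ y ∈ B, g x x y = x ∧ g x y x = x ∧ g y x x = x

/-- A ternary operation is a Mal'tsev operation on a set `B`. -/
def IsMaltsevOn {α : Type} (h : α → α → α → α) (B : Set α) : Prop :=
  ∀ x ∈ B, ∀ y ∈ B, h x y y = x ∧ h y y x = x

namespace UAlgebra

variable {σ : Signature}

/-- An algebra is "a set": every term operation is a projection. -/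
def IsSetAlgebra (Q : UAlgebra σ) : Prop :=
  ∀ (n : ℕ) (t : Term σ n), ∃ i : Fin n, ∀ x : Fin n → Q.carrier, t.eval Q x = x i

/-- An algebra is the full idempotent reduct of a module over some finite ring:
its term operations are exactly the idempotent affine combinations; in
particular the affine operation `x - y + z` is a term operation. -/
def IsAffineAlgebra (Q : UAlgebra σ) : Prop :=
  ∃ (R : Type) (_ : Ring R) (_ : Finite R) (_ : AddCommGroup Q.carrier)
    (_ : Module R Q.carrier),
    (∀ (n : ℕ) (g : (Fin n → Q.carrier) → Q.carrier),
      (∃ t : Term σ n, ∀ x, t.eval Q x = g x) ↔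
      (∃ c : Fin n → R, (∑ i, c i) = 1 ∧ ∀ x, g x = ∑ i, c i • x i)) ∧
    (∃ t : Term σ 3, ∀ x y z : Q.carrier, t.eval Q ![x, y, z] = x - y + z)

/-- `θ` witnesses that `ab` is an edge of the unary type. -/
def UnaryWitness (A : UAlgebra σ) (a b : A.carrier) (θ : Congruence (A.Sg {a, b})) : Prop :=
  θ.IsMaximal ∧ IsSetAlgebra ((A.Sg {a, b}).quot θ)

/-- `θ` witnesses that `ab` is an edge of the semilattice type. -/
def SLWitness (A : UAlgebra σ) (a b : A.carrier) (θ : Congruence (A.Sg {a, b})) : Prop :=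
  θ.IsMaximal ∧ ∃ t : Term σ 2,
    IsSemilatticeOn (fun x y => t.eval ((A.Sg {a, b}).quot θ) ![x, y])
      {A.qa a b θ, A.qb a b θ}

/-- `θ` witnesses that `ab` is an edge of the majority type. -/
def MajWitness (A : UAlgebra σ) (a b : A.carrier) (θ : Congruence (A.Sg {a, b})) : Prop :=
  θ.IsMaximal ∧
  (∃ t : Term σ 3,
    IsMajorityOn (fun x y z => t.eval ((A.Sg {a, b}).quot θ) ![x, y, z])
      {A.qa a b θ, A.qb a b θ}) ∧
  ¬ (∃ t : Term σ 2,
    IsSemilatticeOn (fun x y => t.eval ((A.Sg {a, b}).quot θ) ![x, y])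
      {A.qa a b θ, A.qb a b θ})

/-- `θ` witnesses that `ab` is an edge of the affine type. -/
def AffWitness (A : UAlgebra σ) (a b : A.carrier) (θ : Congruence (A.Sg {a, b})) : Prop :=
  θ.IsMaximal ∧ IsAffineAlgebra ((A.Sg {a, b}).quot θ)

/-- A pair of distinct elements is an edge. -/
def IsEdge (A : UAlgebra σ) (a b : A.carrier) : Prop :=
  a ≠ b ∧ ∃ θ : Congruence (A.Sg {a, b}), ¬ θ.IsFull ∧
    (IsSetAlgebra ((A.Sg {a, b}).quot θ) ∨
     IsAffineAlgebra ((A.Sg {a, b}).quot θ) ∨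
     (∃ t : Term σ 2,
        IsSemilatticeOn (fun x y => t.eval ((A.Sg {a, b}).quot θ) ![x, y])
          {A.qa a b θ, A.qb a b θ}) ∨
     (∃ t : Term σ 3,
        IsMajorityOn (fun x y z => t.eval ((A.Sg {a, b}).quot θ) ![x, y, z])
          {A.qa a b θ, A.qb a b θ}))

def IsUnaryEdge (A : UAlgebra σ) (a b : A.carrier) : Prop :=
  a ≠ b ∧ ∃ θ : Congruence (A.Sg {a, b}), UnaryWitness A a b θ

def IsSLEdge (A : UAlgebra σ) (a b : A.carrier) : Prop :=
  a ≠ b ∧ ∃ θ : Congruence (A.Sg {a, b}), SLWitness A a b θ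

def IsMajEdge (A : UAlgebra σ) (a b : A.carrier) : Prop :=
  a ≠ b ∧ ∃ θ : Congruence (A.Sg {a, b}), MajWitness A a b θ

def IsAffEdge (A : UAlgebra σ) (a b : A.carrier) : Prop :=
  a ≠ b ∧ ∃ θ : Congruence (A.Sg {a, b}), AffWitness A a b θ

end UAlgebra

/-- The four types of edges. -/
inductive EdgeType where
  | unary | semilattice | majority | affine
deriving DecidableEq

namespace UAlgebra

variable {σ : Signature}

def HasEdgeOfType (A : UAlgebra σ) (τ : EdgeType) (a b : A.carrier) : Prop :=
  match τ with
  | .unary => A.IsUnaryEdge a b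
  | .semilattice => A.IsSLEdge a b
  | .majority => A.IsMajEdge a b
  | .affine => A.IsAffEdge a b

/-- `T`-restricted algebra: every edge has a type from `T`. -/
def Restricted (A : UAlgebra σ) (T : Set EdgeType) : Prop :=
  ∀ a b : A.carrier, A.IsEdge a b → ∃ τ ∈ T, A.HasEdgeOfType τ a b

/-- `A` omits type 1: no subalgebra of `A` has an edge of the unary type. -/
def OmitsType1 (A : UAlgebra σ) : Prop :=
  ∀ (S : Set A.carrier) (hS : A.IsClosed S) (a b : (A.subalg S hS).carrier),
    ¬ (A.subalg S hS).IsUnaryEdge a b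

/-- The union of the two `θ`-blocks of a thick edge, as a subset of `A`. -/
def edgeBlockUnion (A : UAlgebra σ) (a b : A.carrier) (θ : Congruence (A.Sg {a, b})) :
    Set A.carrier :=
  {x | ∃ hx : x ∈ A.ClosureSet {a, b},
    θ.rel ⟨x, hx⟩ (A.sgA a b) ∨ θ.rel ⟨x, hx⟩ (A.sgB a b)}

/-- Smooth algebra: for every semilattice- or majority-type edge with a witnessing
maximal congruence, the union of the two blocks is a subuniverse. -/
def IsSmooth (A : UAlgebra σ) : Prop :=
  ∀ (a b : A.carrier) (θ : Congruence (A.Sg {a, b})),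
    (SLWitness A a b θ ∨ MajWitness A a b θ) → A.IsClosed (A.edgeBlockUnion a b θ)

def SemilatticeFree (A : UAlgebra σ) : Prop := ∀ a b : A.carrier, ¬ A.IsSLEdge a b
def MajorityFree (A : UAlgebra σ) : Prop := ∀ a b : A.carrier, ¬ A.IsMajEdge a b
def AffineFree (A : UAlgebra σ) : Prop := ∀ a b : A.carrier, ¬ A.IsAffEdge a b

/-- Thin semilattice edge. -/
def IsThinSLEdge (A : UAlgebra σ) (a b : A.carrier) : Prop :=
  ∃ t : Term σ 2, t.eval A ![a, a] = a ∧ t.eval A ![a, b] = b ∧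
    t.eval A ![b, a] = b ∧ t.eval A ![b, b] = b

/-- Undirected thin majority edge: some term operation is majority on `{a, b}`. -/
def IsUndirThinMajEdge (A : UAlgebra σ) (a b : A.carrier) : Prop :=
  ∃ t : Term σ 3, IsMajorityOn (fun x y z => t.eval A ![x, y, z]) {a, b}

/-- Mal'tsev edge: some term operation is Mal'tsev on `{a, b}`. -/
def IsMaltsevEdge (A : UAlgebra σ) (a b : A.carrier) : Prop :=
  ∃ t : Term σ 3, IsMaltsevOn (fun x y z => t.eval A ![x, y, z]) {a, b}

/-- The class of all quotients of subalgebras of `A`. -/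
def QuotSub (A : UAlgebra σ) : Set (UAlgebra σ) :=
  {B | ∃ (S : Set A.carrier) (hS : A.IsClosed S)
        (θ : Congruence (A.subalg S hS)), B = (A.subalg S hS).quot θ}

end UAlgebra

/-- The class of all quotients of subalgebras of the algebras of a class. -/
def QuotSubClass {σ : Signature} (K : Set (UAlgebra σ)) : Set (UAlgebra σ) :=
  {B | ∃ A ∈ K, B ∈ UAlgebra.QuotSub A}

/-- A ternary term satisfies the majority condition relative to a class `𝒦`. -/
def MajorityCondition {σ : Signature} (𝒦 : Set (UAlgebra σ)) (t : Term σ 3) : Prop :=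
  (∀ B ∈ 𝒦, ∀ x y : B.carrier,
    t.eval B ![x, t.eval B ![x, y, y], t.eval B ![x, y, y]] = t.eval B ![x, y, y]) ∧
  (∀ B ∈ 𝒦, ∀ (a b : B.carrier) (θ : UAlgebra.Congruence (B.Sg {a, b})),
    a ≠ b → UAlgebra.MajWitness B a b θ →
    IsMajorityOn (fun x y z => t.eval ((B.Sg {a, b}).quot θ) ![x, y, z])
      {B.qa a b θ, B.qb a b θ})

/-- A ternary term satisfies the minority condition relative to a class `𝒦`. -/
def MinorityCondition {σ : Signature} (𝒦 : Set (UAlgebra σ)) (t : Term σ 3) : Prop :=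
  (∀ B ∈ 𝒦, ∀ x y : B.carrier,
    t.eval B ![t.eval B ![x, y, y], y, y] = t.eval B ![x, y, y]) ∧
  (∀ B ∈ 𝒦, ∀ (a b : B.carrier) (θ : UAlgebra.Congruence (B.Sg {a, b})),
    a ≠ b → UAlgebra.AffWitness B a b θ →
    IsMaltsevOn (fun x y z => t.eval ((B.Sg {a, b}).quot θ) ![x, y, z])
      {B.qa a b θ, B.qb a b θ})

/-- Thin majority edge relative to a class `𝒦`. -/
def IsThinMajEdge {σ : Signature} (𝒦 : Set (UAlgebra σ)) (A : UAlgebra σ)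
    (a b : A.carrier) : Prop :=
  ∀ t : Term σ 3, MajorityCondition 𝒦 t →
    b ∈ A.ClosureSet {a, t.eval A ![a, b, b]} ∧
    b ∈ A.ClosureSet {a, t.eval A ![b, a, b]} ∧
    b ∈ A.ClosureSet {a, t.eval A ![b, b, a]}

/-- Thin affine edge relative to a class `𝒦` (with respect to some fixed term
operation satisfying the minority condition). -/
def IsThinAffEdge {σ : Signature} (𝒦 : Set (UAlgebra σ)) (A : UAlgebra σ)
    (a b : A.carrier) : Prop :=
  (∃ t : Term σ 3, MinorityCondition 𝒦 t ∧ t.eval A ![b, a, a] = b) ∧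
  ∀ t : Term σ 3, MinorityCondition 𝒦 t → b ∈ A.ClosureSet {a, t.eval A ![a, a, b]}

namespace UAlgebra

variable {σ : Signature}

/-- Reachability in the digraph `Gs(A)` of thin semilattice edges. -/
def sReach (A : UAlgebra σ) : A.carrier → A.carrier → Prop :=
  Relation.ReflTransGen (fun x y => A.IsThinSLEdge x y)

/-- A maximal element of `Gs(A)`: an element of a maximal strongly connected
component. -/
def IsMaxElem (A : UAlgebra σ) (a : A.carrier) : Prop :=
  ∀ b, A.sReach a b → A.sReach b a

/-- A maximal component of `Gs(A)`: the strongly connected component of a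
maximal element. -/
def IsMaxComponent (A : UAlgebra σ) (C : Set A.carrier) : Prop :=
  ∃ a, A.IsMaxElem a ∧ C = {b | A.sReach a b ∧ A.sReach b a}

end UAlgebra

/-- An arc of the digraph `Gas(A)`: a thin semilattice or thin affine edge. -/
def asStep {σ : Signature} (𝒦 : Set (UAlgebra σ)) (A : UAlgebra σ)
    (x y : A.carrier) : Prop :=
  A.IsThinSLEdge x y ∨ IsThinAffEdge 𝒦 A x y

/-- Reachability in `Gas(A)`. -/
def asReach {σ : Signature} (𝒦 : Set (UAlgebra σ)) (A : UAlgebra σ) :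
    A.carrier → A.carrier → Prop :=
  Relation.ReflTransGen (asStep 𝒦 A)

/-- An as-maximal element: an element of an as-component. -/
def IsAsMaxElem {σ : Signature} (𝒦 : Set (UAlgebra σ)) (A : UAlgebra σ)
    (a : A.carrier) : Prop :=
  ∀ b, asReach 𝒦 A a b → asReach 𝒦 A b a

/-- An as-component of `A`: a maximal strongly connected component of `Gas(A)`. -/
def IsAsComponent {σ : Signature} (𝒦 : Set (UAlgebra σ)) (A : UAlgebra σ)
    (C : Set A.carrier) : Prop :=
  ∃ a, IsAsMaxElem 𝒦 A a ∧ C = {b | asReach 𝒦 A a b ∧ asReach 𝒦 A b a}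

namespace UAlgebra

variable {σ : Signature}

/-- Binary direct product. -/
def prod (A B : UAlgebra σ) : UAlgebra σ where
  carrier := A.carrier × B.carrier
  interp f x := (A.interp f fun j => (x j).1, B.interp f fun j => (x j).2)

/-- Direct product of a family. -/
def pi {ι : Type} (A : ι → UAlgebra σ) : UAlgebra σ where
  carrier := ∀ i, (A i).carrier
  interp f x := fun i => (A i).interp f fun j => x j i

/-- Homomorphism of similar algebras. -/
def IsHom (A B : UAlgebra σ) (φ : A.carrier → B.carrier) : Prop :=
  ∀ (f : σ.ops) (x : Fin (σ.arity f) → A.carrier),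
    φ (A.interp f x) = B.interp f fun j => φ (x j)

/-- Simple algebra: only the equality and full congruences. -/
def IsSimple (A : UAlgebra σ) : Prop :=
  ∀ θ : Congruence A, (∀ x y, θ.rel x y ↔ x = y) ∨ θ.IsFull

/-- Maximal generated algebra: generated by one of its maximal components. -/
def MaximalGenerated (A : UAlgebra σ) : Prop :=
  ∃ C : Set A.carrier, A.IsMaxComponent C ∧ A.ClosureSet C = Set.univ

/-- The number of subalgebras (nonempty closed subsets) of an algebra. -/
noncomputable def numSubalgebras (A : UAlgebra σ) : ℕ :=
  Nat.card {S : Set A.carrier // S.Nonempty ∧ A.IsClosed S}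

end UAlgebra

/-- A (k+3)-ary term is an edge term for a class `𝒦`. -/
def IsEdgeTermFor {σ : Signature} (𝒦 : Set (UAlgebra σ)) {k : ℕ}
    (t : Term σ (k + 3)) : Prop :=
  ∀ A ∈ 𝒦, ∀ x y : A.carrier,
    t.eval A (fun i => if i.val ≤ 1 then y else x) = x ∧
    t.eval A (fun i => if i.val = 0 ∨ i.val = 2 then y else x) = x ∧
    ∀ j : Fin (k + 3), 3 ≤ j.val →
      t.eval A (Function.update (fun _ => x) j y) = x

/-- A finite class has few subproducts. -/
def FewSubproducts {σ : Signature} (K : Set (UAlgebra σ)) : Prop :=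
  ∃ p : Polynomial ℕ, ∀ (n : ℕ) (A : Fin n → UAlgebra σ), (∀ i, A i ∈ K) →
    UAlgebra.numSubalgebras (UAlgebra.pi A) ≤ 2 ^ (p.eval n)

/-- `g_K` is bounded by a polynomial: every subalgebra of an `n`-fold product
of members of `K` has a generating set of polynomial size. -/
def PolyGenerated {σ : Signature} (K : Set (UAlgebra σ)) : Prop :=
  ∃ p : Polynomial ℕ, ∀ (n : ℕ) (A : Fin n → UAlgebra σ), (∀ i, A i ∈ K) →
    ∀ S : Set (UAlgebra.pi A).carrier, S.Nonempty → (UAlgebra.pi A).IsClosed S →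
      ∃ G : Set (UAlgebra.pi A).carrier, G ⊆ S ∧ G.Finite ∧
        G.ncard ≤ p.eval n ∧ (UAlgebra.pi A).ClosureSet G = S

section TermCalculus

variable {σ : Signature}

/-- Substitution of terms for the variables of a term. -/
def Term.sub {n m : ℕ} : Term σ n → (Fin n → Term σ m) → Term σ m
  | .var i, u => u i
  | .app f ts, u => .app f fun j => (ts j).sub u

theorem Term.eval_sub {n m : ℕ} (A : UAlgebra σ) (t : Term σ n) (u : Fin n → Term σ m)
    (x : Fin m → A.carrier) : (t.sub u).eval A x = t.eval A fun i => (u i).eval A x := by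
  induction t with
  | var i => rfl
  | app f ts ih =>
    simp only [Term.sub, Term.eval]
    congr 1
    funext j
    exact ih j

namespace UAlgebra

/-- Evaluation of a binary term. -/
def b2 (A : UAlgebra σ) (t : Term σ 2) (x y : A.carrier) : A.carrier := t.eval A ![x, y]

/-- Evaluation of a ternary term. -/
def b3 (A : UAlgebra σ) (t : Term σ 3) (x y z : A.carrier) : A.carrier := t.eval A ![x, y, z]

/-- Substitution of terms in a binary term. -/
def c2 {m : ℕ} (t : Term σ 2) (u v : Term σ m) : Term σ m := t.sub ![u, v]

/-- Substitution of terms in a ternary term. -/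
def c3 {m : ℕ} (t : Term σ 3) (u v w : Term σ m) : Term σ m := t.sub ![u, v, w]

/-- The binary term `x`. -/
def p0 : Term σ 2 := .var 0
/-- The binary term `y`. -/
def p1 : Term σ 2 := .var 1
/-- The ternary term `x`. -/
def q0 : Term σ 3 := .var 0
/-- The ternary term `y`. -/
def q1 : Term σ 3 := .var 1
/-- The ternary term `z`. -/
def q2 : Term σ 3 := .var 2

variable (A B : UAlgebra σ)

theorem eval_c2 {m : ℕ} (t : Term σ 2) (u v : Term σ m) (x : Fin m → A.carrier) :
    (c2 t u v).eval A x = b2 A t (u.eval A x) (v.eval A x) := by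
  rw [c2, Term.eval_sub, b2]; congr 1; funext i; fin_cases i <;> rfl

theorem eval_c3 {m : ℕ} (t : Term σ 3) (u v w : Term σ m) (x : Fin m → A.carrier) :
    (c3 t u v w).eval A x = b3 A t (u.eval A x) (v.eval A x) (w.eval A x) := by
  rw [c3, Term.eval_sub, b3]; congr 1; funext i; fin_cases i <;> rfl

@[simp] theorem b2_c2 (t u v : Term σ 2) (x y : A.carrier) :
    b2 A (c2 t u v) x y = b2 A t (b2 A u x y) (b2 A v x y) := eval_c2 A t u v _
@[simp] theorem b3_c2 (t : Term σ 2) (u v : Term σ 3) (x y z : A.carrier) :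
    b3 A (c2 t u v) x y z = b2 A t (b3 A u x y z) (b3 A v x y z) := eval_c2 A t u v _
@[simp] theorem b2_c3 (t : Term σ 3) (u v w : Term σ 2) (x y : A.carrier) :
    b2 A (c3 t u v w) x y = b3 A t (b2 A u x y) (b2 A v x y) (b2 A w x y) := eval_c3 A t u v w _
@[simp] theorem b3_c3 (t u v w : Term σ 3) (x y z : A.carrier) :
    b3 A (c3 t u v w) x y z = b3 A t (b3 A u x y z) (b3 A v x y z) (b3 A w x y z) :=
  eval_c3 A t u v w _
@[simp] theorem b2_p0 (x y : A.carrier) : b2 A p0 x y = x := rfl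
@[simp] theorem b2_p1 (x y : A.carrier) : b2 A p1 x y = y := rfl
@[simp] theorem b3_q0 (x y z : A.carrier) : b3 A q0 x y z = x := rfl
@[simp] theorem b3_q1 (x y z : A.carrier) : b3 A q1 x y z = y := rfl
@[simp] theorem b3_q2 (x y z : A.carrier) : b3 A q2 x y z = z := rfl

variable {A B}

theorem Idempotent.eval (h : A.Idempotent) {n : ℕ} (t : Term σ n) (x : Fin n → A.carrier)
    (a : A.carrier) (hx : ∀ i, x i = a) : t.eval A x = a := by
  induction t with
  | var i => exact hx i
  | app f ts ih =>
    simp only [Term.eval]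
    rw [funext ih]
    exact h f a

theorem Idempotent.b2 (h : A.Idempotent) (t : Term σ 2) (x : A.carrier) : b2 A t x x = x :=
  h.eval t _ x fun i => by fin_cases i <;> rfl

theorem Idempotent.b3 (h : A.Idempotent) (t : Term σ 3) (x : A.carrier) : b3 A t x x x = x :=
  h.eval t _ x fun i => by fin_cases i <;> rfl

theorem IsHom.eval {φ : A.carrier → B.carrier} (h : A.IsHom B φ) {n : ℕ} (t : Term σ n)
    (x : Fin n → A.carrier) : φ (t.eval A x) = t.eval B fun i => φ (x i) := by
  induction t with
  | var i => rfl
  | app f ts ih =>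
    simp only [Term.eval]
    rw [h, funext ih]

theorem IsHom.b2 {φ : A.carrier → B.carrier} (h : A.IsHom B φ) (t : Term σ 2)
    (x y : A.carrier) : φ (b2 A t x y) = b2 B t (φ x) (φ y) := by
  unfold UAlgebra.b2
  rw [h.eval]; congr 1; funext i; fin_cases i <;> rfl

theorem IsHom.b3 {φ : A.carrier → B.carrier} (h : A.IsHom B φ) (t : Term σ 3)
    (x y z : A.carrier) : φ (b3 A t x y z) = b3 B t (φ x) (φ y) (φ z) := by
  unfold UAlgebra.b3
  rw [h.eval]; congr 1; funext i; fin_cases i <;> rfl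

theorem IsClosed.eval {D : Set A.carrier} (h : A.IsClosed D) {n : ℕ} (t : Term σ n)
    (x : Fin n → A.carrier) (hx : ∀ i, x i ∈ D) : t.eval A x ∈ D := by
  induction t with
  | var i => exact hx i
  | app f ts ih => exact h f _ ih

theorem IsClosed.b2 {D : Set A.carrier} (h : A.IsClosed D) (t : Term σ 2) {x y : A.carrier}
    (hx : x ∈ D) (hy : y ∈ D) : A.b2 t x y ∈ D :=
  h.eval t _ fun i => by fin_cases i <;> assumption

theorem IsClosed.b3 {D : Set A.carrier} (h : A.IsClosed D) (t : Term σ 3) {x y z : A.carrier}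
    (hx : x ∈ D) (hy : y ∈ D) (hz : z ∈ D) : A.b3 t x y z ∈ D :=
  h.eval t _ fun i => by fin_cases i <;> assumption

/-- A binary relation between two algebras that is a subuniverse of the product. -/
def Compat (A B : UAlgebra σ) (U : A.carrier → B.carrier → Prop) : Prop :=
  ∀ (f : σ.ops) (x : Fin (σ.arity f) → A.carrier) (y : Fin (σ.arity f) → B.carrier),
    (∀ j, U (x j) (y j)) → U (A.interp f x) (B.interp f y)

theorem Compat.eval {U : A.carrier → B.carrier → Prop} (h : Compat A B U) {n : ℕ}
    (t : Term σ n) (x : Fin n → A.carrier) (y : Fin n → B.carrier) (hx : ∀ i, U (x i) (y i)) :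
    U (t.eval A x) (t.eval B y) := by
  induction t with
  | var i => exact hx i
  | app f ts ih => exact h f _ _ ih

theorem Compat.b2 {U : A.carrier → B.carrier → Prop} (h : Compat A B U) (t : Term σ 2)
    {x x' : A.carrier} {y y' : B.carrier} (hx : U x y) (hy : U x' y') :
    U (A.b2 t x x') (B.b2 t y y') :=
  h.eval t _ _ fun i => by fin_cases i <;> assumption

theorem Compat.b3 {U : A.carrier → B.carrier → Prop} (h : Compat A B U) (t : Term σ 3)
    {x x' x'' : A.carrier} {y y' y'' : B.carrier} (hx : U x y) (hy : U x' y') (hz : U x'' y'') :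
    U (A.b3 t x x' x'') (B.b3 t y y' y'') :=
  h.eval t _ _ fun i => by fin_cases i <;> assumption

/-- Binary product, with a transparent carrier. -/
abbrev pr (A B : UAlgebra σ) : UAlgebra σ where
  carrier := A.carrier × B.carrier
  interp f x := (A.interp f fun j => (x j).1, B.interp f fun j => (x j).2)

/-- The square of an algebra. -/
abbrev sq (A : UAlgebra σ) : UAlgebra σ := pr A A

theorem isHom_fst : (pr A B).IsHom A Prod.fst := fun _ _ => rfl
theorem isHom_snd : (pr A B).IsHom B Prod.snd := fun _ _ => rfl
theorem isHom_swap : (pr A B).IsHom (pr B A) Prod.swap := fun _ _ => rfl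

@[simp] theorem b2_pr (t : Term σ 2) (x y : A.carrier × B.carrier) :
    b2 (pr A B) t x y = (b2 A t x.1 y.1, b2 B t x.2 y.2) :=
  Prod.ext ((isHom_fst (A := A) (B := B)).b2 t x y) ((isHom_snd (A := A) (B := B)).b2 t x y)

@[simp] theorem b3_pr (t : Term σ 3) (x y z : A.carrier × B.carrier) :
    b3 (pr A B) t x y z = (b3 A t x.1 y.1 z.1, b3 B t x.2 y.2 z.2) :=
  Prod.ext ((isHom_fst (A := A) (B := B)).b3 t x y z) ((isHom_snd (A := A) (B := B)).b3 t x y z)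

theorem Idempotent.pr (hA : A.Idempotent) (hB : B.Idempotent) : (pr A B).Idempotent :=
  fun f a => Prod.ext (hA f a.1) (hB f a.2)

/-- `z` lies in the subalgebra generated by `x` and `y`. -/
def Gen2 (A : UAlgebra σ) (x y z : A.carrier) : Prop := ∃ s : Term σ 2, b2 A s x y = z

theorem Gen2.left (x y : A.carrier) : Gen2 A x y x := ⟨p0, rfl⟩
theorem Gen2.right (x y : A.carrier) : Gen2 A x y y := ⟨p1, rfl⟩

theorem Gen2.b2 {x y u v : A.carrier} (t : Term σ 2) (hu : Gen2 A x y u) (hv : Gen2 A x y v) :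
    Gen2 A x y (b2 A t u v) := by
  obtain ⟨s, rfl⟩ := hu
  obtain ⟨s', rfl⟩ := hv
  exact ⟨c2 t s s', by simp⟩

theorem Gen2.trans {x y u v z : A.carrier} (hu : Gen2 A x y u) (hv : Gen2 A x y v)
    (h : Gen2 A u v z) : Gen2 A x y z := by
  obtain ⟨s, rfl⟩ := h
  exact hu.b2 s hv

theorem Gen2.symm {x y z : A.carrier} (h : Gen2 A x y z) : Gen2 A y x z :=
  (Gen2.right y x).trans (Gen2.left y x) h

theorem Gen2.hom {φ : A.carrier → B.carrier} (hφ : A.IsHom B φ) {x y z : A.carrier}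
    (h : Gen2 A x y z) : Gen2 B (φ x) (φ y) (φ z) := by
  obtain ⟨s, rfl⟩ := h
  exact ⟨s, (hφ.b2 s x y).symm⟩

theorem Gen2.closed {D : Set A.carrier} (hD : A.IsClosed D) {x y z : A.carrier}
    (h : Gen2 A x y z) (hx : x ∈ D) (hy : y ∈ D) : z ∈ D := by
  obtain ⟨s, rfl⟩ := h
  exact hD.b2 s hx hy

theorem gen2_isClosed (x y : A.carrier) : A.IsClosed {z | Gen2 A x y z} := by
  intro f u hu
  choose s hs using hu
  refine ⟨.app f s, ?_⟩
  simp only [UAlgebra.b2, Term.eval]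
  exact congrArg _ (funext hs)

theorem gen2_iff_closureSet (x y z : A.carrier) : Gen2 A x y z ↔ z ∈ A.ClosureSet {x, y} := by
  constructor
  · intro h
    exact h.closed (A.closureSet_isClosed _) (.base (by simp)) (.base (by simp))
  · intro h
    induction h with
    | base h =>
      rcases h with rfl | h
      · exact Gen2.left _ _
      · rw [Set.mem_singleton_iff] at h
        subst h
        exact Gen2.right _ _
    | app f u _ ih => exact gen2_isClosed x y f u ih

/-- The number of elements of the subalgebra generated by `x` and `y`. -/
noncomputable def size (A : UAlgebra σ) (x y : A.carrier) : ℕ := {z | Gen2 A x y z}.ncard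

theorem size_le [Finite A.carrier] {x y u v : A.carrier} (hu : Gen2 A x y u)
    (hv : Gen2 A x y v) : size A u v ≤ size A x y :=
  Set.ncard_le_ncard (fun _ hz => hu.trans hv hz) (Set.toFinite _)

theorem size_lt [Finite A.carrier] {x y u v z : A.carrier} (hu : Gen2 A x y u)
    (hv : Gen2 A x y v) (hz : Gen2 A x y z) (hz' : ¬ Gen2 A u v z) : size A u v < size A x y :=
  Set.ncard_lt_ncard ⟨fun _ hz => hu.trans hv hz, fun h => hz' (h hz)⟩ (Set.toFinite _)

theorem gen2_of_size_le [Finite A.carrier] {x y u v z : A.carrier} (hu : Gen2 A x y u)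
    (hv : Gen2 A x y v) (h : size A x y ≤ size A u v) (hz : Gen2 A x y z) : Gen2 A u v z := by
  by_contra hn
  exact absurd (size_lt hu hv hz hn) (not_lt.mpr h)

theorem size_hom_inj {φ : A.carrier → B.carrier} (hφ : A.IsHom B φ)
    (hi : Function.Injective φ) (x y : A.carrier) : size B (φ x) (φ y) = size A x y := by
  unfold size
  have : {z | Gen2 B (φ x) (φ y) z} = φ '' {z | Gen2 A x y z} := by
    ext z
    constructor
    · rintro ⟨s, rfl⟩
      exact ⟨_, ⟨s, rfl⟩, hφ.b2 s x y⟩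
    · rintro ⟨z, hz, rfl⟩
      exact hz.hom hφ
  rw [this]
  exact Set.ncard_image_of_injective _ hi

/-- Thin semilattice edges, for idempotent algebras. -/
def Th (A : UAlgebra σ) (a b : A.carrier) : Prop :=
  ∃ t : Term σ 2, b2 A t a b = b ∧ b2 A t b a = b

theorem isThinSLEdge_iff (h : A.Idempotent) (a b : A.carrier) : A.IsThinSLEdge a b ↔ Th A a b :=
  ⟨fun ⟨t, _, h1, h2, _⟩ => ⟨t, h1, h2⟩, fun ⟨t, h1, h2⟩ => ⟨t, h.b2 t a, h1, h2, h.b2 t b⟩⟩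

theorem Th.hom {φ : A.carrier → B.carrier} (hφ : A.IsHom B φ) {a b : A.carrier}
    (h : Th A a b) : Th B (φ a) (φ b) := by
  obtain ⟨t, h1, h2⟩ := h
  exact ⟨t, by rw [← hφ.b2, h1], by rw [← hφ.b2, h2]⟩

theorem Th.of_inj {φ : A.carrier → B.carrier} (hφ : A.IsHom B φ) (hi : Function.Injective φ)
    {a b : A.carrier} (h : Th B (φ a) (φ b)) : Th A a b := by
  obtain ⟨t, h1, h2⟩ := h
  exact ⟨t, hi (by rw [hφ.b2, h1]), hi (by rw [hφ.b2, h2])⟩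

/-- The values at the three near-unanimous tuples over `x, y` of a single ternary term. -/
def R3 (A : UAlgebra σ) (x y u v w : A.carrier) : Prop :=
  ∃ p : Term σ 3, b3 A p x x y = u ∧ b3 A p x y x = v ∧ b3 A p y x x = w

theorem R3.b2 {x y u v w u' v' w' : A.carrier} (t : Term σ 2) (h : R3 A x y u v w)
    (h' : R3 A x y u' v' w') : R3 A x y (b2 A t u u') (b2 A t v v') (b2 A t w w') := by
  obtain ⟨p, rfl, rfl, rfl⟩ := h
  obtain ⟨p', rfl, rfl, rfl⟩ := h'
  exact ⟨c2 t p p', by simp⟩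

theorem R3.b3 {x y u v w u' v' w' u'' v'' w'' : A.carrier} (t : Term σ 3)
    (h : R3 A x y u v w) (h' : R3 A x y u' v' w') (h'' : R3 A x y u'' v'' w'') :
    R3 A x y (b3 A t u u' u'') (b3 A t v v' v'') (b3 A t w w' w'') := by
  obtain ⟨p, rfl, rfl, rfl⟩ := h
  obtain ⟨p', rfl, rfl, rfl⟩ := h'
  obtain ⟨p'', rfl, rfl, rfl⟩ := h''
  exact ⟨c3 t p p' p'', by simp⟩

theorem R3.swap12 {x y u v w : A.carrier} (h : R3 A x y u v w) : R3 A x y v u w := by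
  obtain ⟨p, rfl, rfl, rfl⟩ := h
  exact ⟨c3 p q0 q2 q1, by simp⟩

theorem R3.swap23 {x y u v w : A.carrier} (h : R3 A x y u v w) : R3 A x y u w v := by
  obtain ⟨p, rfl, rfl, rfl⟩ := h
  exact ⟨c3 p q1 q0 q2, by simp⟩

theorem R3.rot {x y u v w : A.carrier} (h : R3 A x y u v w) : R3 A x y v w u := h.swap12.swap23

theorem r3_gen (x y : A.carrier) : R3 A x y x x y := ⟨q0, by simp⟩

theorem R3.hom {φ : A.carrier → B.carrier} (hφ : A.IsHom B φ) {x y u v w : A.carrier}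
    (h : R3 A x y u v w) : R3 B (φ x) (φ y) (φ u) (φ v) (φ w) := by
  obtain ⟨p, rfl, rfl, rfl⟩ := h
  exact ⟨p, by simp [hφ.b3]⟩

/-- One step of the simultaneous ascent of the two components of a pair. -/
def Step (A : UAlgebra σ) (p q : A.carrier × A.carrier) : Prop :=
  Gen2 (sq A) p p.swap q ∧ Th (sq A) p q

/-- Reachability by steps. -/
def LR (A : UAlgebra σ) : A.carrier × A.carrier → A.carrier × A.carrier → Prop :=
  Relation.ReflTransGen (Step A)

theorem Step.hom {φ : A.carrier → B.carrier} (hφ : A.IsHom B φ) {p q : A.carrier × A.carrier}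
    (h : Step A p q) : Step B (Prod.map φ φ p) (Prod.map φ φ q) := by
  have h2 : (sq A).IsHom (sq B) (Prod.map φ φ) := fun f x => Prod.ext (hφ f _) (hφ f _)
  exact ⟨h.1.hom h2, h.2.hom h2⟩

theorem LR.hom {φ : A.carrier → B.carrier} (hφ : A.IsHom B φ) {p q : A.carrier × A.carrier}
    (h : LR A p q) : LR B (Prod.map φ φ p) (Prod.map φ φ q) :=
  Relation.ReflTransGen.lift (Prod.map φ φ) (fun _ _ => Step.hom hφ) _ _ h

theorem Step.swap {p q : A.carrier × A.carrier} (h : Step A p q) : Step A p.swap q.swap := by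
  have h2 : (sq A).IsHom (sq A) Prod.swap := isHom_swap
  exact ⟨h.1.hom h2, h.2.hom h2⟩

theorem LR.swap {p q : A.carrier × A.carrier} (h : LR A p q) : LR A p.swap q.swap :=
  Relation.ReflTransGen.lift Prod.swap (fun _ _ => Step.swap) _ _ h

theorem Step.gen {p q : A.carrier × A.carrier} (h : Step A p q) {z : A.carrier}
    (hz : Gen2 A q.1 q.2 z) : Gen2 A p.1 p.2 z :=
  Gen2.trans (h.1.hom isHom_fst) ((h.1.hom isHom_snd).symm) hz

theorem LR.gen {p q : A.carrier × A.carrier} (h : LR A p q) {z : A.carrier}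
    (hz : Gen2 A q.1 q.2 z) : Gen2 A p.1 p.2 z := by
  induction h with
  | refl => exact hz
  | tail _ h ih => exact ih (h.gen hz)

theorem Step.r3 (hA : A.Idempotent) {p q : A.carrier × A.carrier} (h : Step A p q)
    {u v w : A.carrier} (hr : R3 A q.1 q.2 u v w) : R3 A p.1 p.2 u v w := by
  obtain ⟨⟨s, hs⟩, t, ht1, ht2⟩ := h
  obtain ⟨r, hr1, hr2, hr3⟩ := hr
  obtain ⟨x, y⟩ := p
  obtain ⟨x1, y1⟩ := q
  simp only [b2_pr, Prod.mk.injEq, Prod.fst_swap, Prod.snd_swap] at hs ht1 ht2 hr1 hr2 hr3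
  obtain ⟨hs1, hs2⟩ := hs
  let g (X Y Z : Term σ 3) : Term σ 3 := c2 t (c2 t X (c2 s X Y)) (c2 s X Z)
  refine ⟨c3 r (g q0 q1 q2) (g q1 q2 q0) (g q2 q0 q1), ?_, ?_, ?_⟩ <;>
    simp [g, hA.b2, hs1, hs2, ht1, ht2, hr1, hr2, hr3]

theorem Step.sq {p q : A.carrier × A.carrier} (h : Step A p q) :
    Step (sq A) (p, p.swap) (q, q.swap) := by
  obtain ⟨⟨s, hs⟩, t, ht1, ht2⟩ := h
  have h2 : (UAlgebra.sq A).IsHom (UAlgebra.sq A) Prod.swap := isHom_swap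
  have hs' := congrArg Prod.swap hs
  have ht1' := congrArg Prod.swap ht1
  have ht2' := congrArg Prod.swap ht2
  rw [h2.b2] at hs' ht1' ht2'
  refine ⟨⟨s, ?_⟩, t, ?_, ?_⟩
  · rw [b2_pr]; exact Prod.ext hs hs'
  · rw [b2_pr]; exact Prod.ext ht1 ht1'
  · rw [b2_pr]; exact Prod.ext ht2 ht2'

theorem LR.sq {p q : A.carrier × A.carrier} (h : LR A p q) :
    LR (sq A) (p, p.swap) (q, q.swap) :=
  Relation.ReflTransGen.lift (fun p : A.carrier × A.carrier => (p, p.swap)) (fun _ _ => Step.sq) _ _ h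

theorem LR.r3 (hA : A.Idempotent) {p q : A.carrier × A.carrier} (h : LR A p q)
    {u v w : A.carrier} (hr : R3 A q.1 q.2 u v w) : R3 A p.1 p.2 u v w := by
  induction h with
  | refl => exact hr
  | tail _ h ih => exact ih (h.r3 hA hr)

theorem LR.r3_sq (hA : A.Idempotent) {p q : A.carrier × A.carrier} (h : LR A p q)
    {u v w : A.carrier × A.carrier} (hr : R3 (UAlgebra.sq A) q q.swap u v w) :
    R3 (UAlgebra.sq A) p p.swap u v w :=
  h.sq.r3 (hA.pr hA) hr

/-- Pairs lying in a maximal strongly connected component of the step digraph. -/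
def LRmax (A : UAlgebra σ) (p : A.carrier × A.carrier) : Prop := ∀ q, LR A p q → LR A q p

theorem LRmax.of_LR {p q : A.carrier × A.carrier} (hp : LRmax A p) (h : LR A p q) :
    LRmax A q := fun r hr => (hp r (h.trans hr)).trans h

theorem exists_terminal {α : Type*} [Finite α] (r : α → α → Prop) (a : α) :
    ∃ b, Relation.ReflTransGen r a b ∧
      ∀ c, Relation.ReflTransGen r b c → Relation.ReflTransGen r c b := by
  obtain ⟨b, hb, hmin⟩ := (Set.toFinite {b | Relation.ReflTransGen r a b}).exists_minimalFor
    (fun b => {c | Relation.ReflTransGen r b c}.ncard) _ ⟨a, .refl⟩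
  refine ⟨b, hb, fun c hc => ?_⟩
  have hsub : {d | Relation.ReflTransGen r c d} ⊆ {d | Relation.ReflTransGen r b d} :=
    fun d hd => hc.trans hd
  have := hmin (hb.trans hc) (Set.ncard_le_ncard hsub (Set.toFinite _))
  have h3 := Set.eq_of_subset_of_ncard_le hsub this (Set.toFinite _)
  have : b ∈ {d | Relation.ReflTransGen r c d} := by rw [h3]; exact .refl
  exact this

theorem exists_LRmax [Finite A.carrier] (p : A.carrier × A.carrier) :
    ∃ q, LR A p q ∧ LRmax A q := exists_terminal (Step A) p

/-- A term that is majority on a pair up to ascent. -/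
def W2 (A : UAlgebra σ) (p : A.carrier × A.carrier) : Prop :=
  ∃ c, LR A p c ∧ R3 (sq A) p p.swap c c c

theorem W2.of_LR (hA : A.Idempotent) {p q : A.carrier × A.carrier} (h : LR A p q)
    (hq : W2 A q) : W2 A p := by
  obtain ⟨c, hc, hr⟩ := hq
  exact ⟨c, h.trans hc, h.r3_sq hA hr⟩

theorem W2.exact (hA : A.Idempotent) {p : A.carrier × A.carrier} (hp : LRmax A p)
    (h : W2 A p) : ∃ c, LR A p c ∧ R3 (sq A) c c.swap c c c := by
  obtain ⟨c, hc, hr⟩ := h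
  exact ⟨c, hc, (hp c hc).r3_sq hA hr⟩

theorem isHom_map {φ : A.carrier → B.carrier} (hφ : A.IsHom B φ) :
    (sq A).IsHom (sq B) (Prod.map φ φ) := fun f _ => Prod.ext (hφ f _) (hφ f _)

theorem W2.hom {φ : A.carrier → B.carrier} (hφ : A.IsHom B φ) {p : A.carrier × A.carrier}
    (h : W2 A p) : W2 B (Prod.map φ φ p) := by
  obtain ⟨c, hc, hr⟩ := h
  exact ⟨_, hc.hom hφ, hr.hom (isHom_map hφ)⟩

theorem Step.lift_inj {φ : A.carrier → B.carrier} (hφ : A.IsHom B φ)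
    (hi : Function.Injective φ) {p : A.carrier × A.carrier} {q : B.carrier × B.carrier}
    (h : Step B (Prod.map φ φ p) q) : ∃ q', q = Prod.map φ φ q' ∧ Step A p q' := by
  obtain ⟨⟨s, hs⟩, ht⟩ := h
  have h1 := (isHom_map hφ).b2 s p p.swap
  have h2 : q = Prod.map φ φ (b2 (UAlgebra.sq A) s p p.swap) := by rw [h1, ← hs]; rfl
  refine ⟨_, h2, ⟨s, rfl⟩, Th.of_inj (isHom_map hφ) (hi.prodMap hi) ?_⟩
  rw [← h2]
  exact ht

theorem LR.lift_inj {φ : A.carrier → B.carrier} (hφ : A.IsHom B φ)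
    (hi : Function.Injective φ) {p : A.carrier × A.carrier} {q : B.carrier × B.carrier}
    (h : LR B (Prod.map φ φ p) q) : ∃ q', q = Prod.map φ φ q' ∧ LR A p q' := by
  induction h with
  | refl => exact ⟨p, rfl, .refl⟩
  | tail _ h ih =>
    obtain ⟨r, rfl, hr⟩ := ih
    obtain ⟨q', rfl, hq⟩ := h.lift_inj hφ hi
    exact ⟨q', rfl, hr.tail hq⟩

theorem LRmax.of_inj {φ : A.carrier → B.carrier} (hφ : A.IsHom B φ)
    (hi : Function.Injective φ) {p : A.carrier × A.carrier} (h : LRmax B (Prod.map φ φ p)) :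
    LRmax A p := by
  intro q hq
  obtain ⟨p', hp, hr⟩ := (h _ (hq.hom hφ)).lift_inj hφ hi
  rwa [← hi.prodMap hi hp] at hr

theorem exists_th_of_absorbing [Finite A.carrier] (hA : A.Idempotent) (x : A.carrier)
    {D : Set A.carrier} (hD : A.IsClosed D) {r : A.carrier} (hr : r ∈ D) (q : Term σ 2)
    (hq : ∀ d ∈ D, b2 A q x d ∈ D ∧ b2 A q d x ∈ D) :
    ∃ d ∈ D, Gen2 A x r d ∧ Th A x d := by
  obtain ⟨d, ⟨hd, hg⟩, hmin⟩ := (Set.toFinite {d | d ∈ D ∧ Gen2 A x r d}).exists_minimalFor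
    (fun d => size A x d) _ ⟨r, hr, Gen2.right _ _⟩
  have key : ∀ e ∈ D, Gen2 A x d e → Gen2 A x e d := by
    intro e he hge
    refine gen2_of_size_le (Gen2.left _ _) hge ?_ (Gen2.right _ _)
    exact hmin ⟨he, (Gen2.left _ _).trans hg hge⟩ (size_le (Gen2.left _ _) hge)
  refine ⟨d, hd, hg, ?_⟩
  obtain ⟨t1, h1⟩ := key _ (hq d hd).1 ⟨q, rfl⟩
  obtain ⟨t2, h2⟩ := key (b2 A t1 d (b2 A q d x)) (hD.b2 t1 hd (hq d hd).2)
    ((Gen2.right _ _).b2 t1 ((Gen2.right _ _).b2 q (Gen2.left _ _)))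
  exact ⟨c2 t2 p1 (c2 t1 p0 (c2 q p0 p1)), by simp [h1, hA.b2], by simp [h2]⟩

theorem Step.lift [Finite A.carrier] (hA : A.Idempotent) (hB : B.Idempotent)
    {φ : A.carrier → B.carrier} (hφ : A.IsHom B φ) {p : A.carrier × A.carrier}
    {q : B.carrier × B.carrier} (h : Step B (Prod.map φ φ p) q) :
    ∃ q', q = Prod.map φ φ q' ∧ Step A p q' := by
  obtain ⟨⟨s, hs⟩, t, ht1, ht2⟩ := h
  have h2 := isHom_map hφ
  have hD : (UAlgebra.sq A).IsClosed {d | Prod.map φ φ d = q} := by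
    intro f x hx
    have : Prod.map φ φ ((UAlgebra.sq A).interp f x) = _ := h2 f x
    rw [Set.mem_ofPred_eq, this, funext hx]
    exact (hB.pr hB) f q
  obtain ⟨d, hd, hg, hth⟩ := exists_th_of_absorbing (hA.pr hA) p hD
    (r := b2 (UAlgebra.sq A) s p p.swap) (by
      rw [Set.mem_ofPred_eq, h2.b2, ← hs]; rfl) t (by
      intro d hd
      rw [Set.mem_ofPred_eq] at hd
      exact ⟨by rw [Set.mem_ofPred_eq, h2.b2, hd, ht1], by rw [Set.mem_ofPred_eq, h2.b2, hd, ht2]⟩)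
  exact ⟨d, hd.symm, (Gen2.left _ _).trans ⟨s, rfl⟩ hg, hth⟩

theorem LR.lift [Finite A.carrier] (hA : A.Idempotent) (hB : B.Idempotent)
    {φ : A.carrier → B.carrier} (hφ : A.IsHom B φ) {p : A.carrier × A.carrier}
    {q : B.carrier × B.carrier} (h : LR B (Prod.map φ φ p) q) :
    ∃ q', q = Prod.map φ φ q' ∧ LR A p q' := by
  induction h with
  | refl => exact ⟨p, rfl, .refl⟩
  | tail _ h ih =>
    obtain ⟨r, rfl, hr⟩ := ih
    obtain ⟨q', rfl, hq⟩ := h.lift hA hB hφ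
    exact ⟨q', rfl, hr.tail hq⟩

theorem LRmax.hom [Finite A.carrier] (hA : A.Idempotent) (hB : B.Idempotent)
    {φ : A.carrier → B.carrier} (hφ : A.IsHom B φ) {p : A.carrier × A.carrier}
    (hp : LRmax A p) : LRmax B (Prod.map φ φ p) := by
  intro q hq
  obtain ⟨q', rfl, h⟩ := hq.lift hA hB hφ
  exact (hp _ h).hom hφ

end UAlgebra

end TermCalculus

section Factors

variable {σ : Signature}

namespace UAlgebra

variable {A B S : UAlgebra σ}

theorem exists_path_of_reflTransGen {α : Type*} {r : α → α → Prop} {a b : α}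
    (h : Relation.ReflTransGen r a b) :
    ∃ (k : ℕ) (c : ℕ → α), c 0 = a ∧ c k = b ∧ (∀ i < k, r (c i) (c (i + 1))) ∧
      ∀ i ≤ k, Relation.ReflTransGen r a (c i) := by
  induction h with
  | refl => exact ⟨0, fun _ => a, rfl, rfl, by simp, fun _ _ => .refl⟩
  | @tail b d hb hd ih =>
    obtain ⟨k, c, h0, hk, hs, hr⟩ := ih
    refine ⟨k + 1, fun i => if i ≤ k then c i else d, by simp [h0], by simp, ?_, ?_⟩
    · intro i hi
      rcases Nat.lt_or_ge i k with h | h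
      · simpa [h.le, Nat.succ_le_of_lt h] using hs i h
      · obtain rfl : i = k := by omega
        simpa [hk] using hd
    · intro i hi
      rcases Nat.lt_or_ge k i with h | h
      · simpa [not_le.mpr h] using hb.tail hd
      · simpa [h] using hr i h

theorem exists_path_of_W2 [Finite A.carrier] (hA : A.Idempotent)
    {a b : A.carrier} (ha : A.IsMaxElem a) (hb : A.IsMaxElem b)
    (hW : ∀ p : A.carrier × A.carrier, W2 A p) :
    ∃ (k : ℕ) (c : ℕ → A.carrier), c 0 = a ∧ c k = b ∧
      (∀ i ≤ k, A.IsMaxElem (c i)) ∧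
      (∀ i < k, A.IsThinSLEdge (c i) (c (i + 1)) ∨
        A.IsUndirThinMajEdge (c i) (c (i + 1))) ∧
      (∀ i < k, ∀ j < k, ¬ A.IsThinSLEdge (c i) (c (i + 1)) →
        ¬ A.IsThinSLEdge (c j) (c (j + 1)) → i = j) := by
  obtain ⟨q, hq, hmax⟩ := exists_LRmax (a, b)
  obtain ⟨⟨c, d⟩, hc, p, hp1, hp2, hp3⟩ := (hW q).exact hA hmax
  have hl := hq.trans hc
  have hfst : A.sReach a c := Relation.ReflTransGen.lift Prod.fst
    (fun _ _ h => (isThinSLEdge_iff hA _ _).2 (h.2.hom isHom_fst)) _ _ hl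
  have hsnd : A.sReach b d := Relation.ReflTransGen.lift Prod.snd
    (fun _ _ h => (isThinSLEdge_iff hA _ _).2 (h.2.hom isHom_snd)) _ _ hl
  have hmaj : A.IsUndirThinMajEdge c d := by
    simp only [b3_pr, Prod.swap_prod_mk, Prod.mk.injEq] at hp1 hp2 hp3
    refine ⟨p, ?_⟩
    rintro x (rfl | rfl) y (rfl | rfl)
    · exact ⟨hA.b3 p _, hA.b3 p _, hA.b3 p _⟩
    · exact ⟨hp1.1, hp2.1, hp3.1⟩
    · exact ⟨hp1.2, hp2.2, hp3.2⟩
    · exact ⟨hA.b3 p _, hA.b3 p _, hA.b3 p _⟩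
  have up : ∀ {x y}, A.IsMaxElem x → A.sReach x y → A.IsMaxElem y :=
    fun hx h z hz => (hx z (h.trans hz)).trans h
  obtain ⟨k, f, hf0, hfk, hfs, hfr⟩ := exists_path_of_reflTransGen hfst
  obtain ⟨l, g, hg0, hgl, hgs, hgr⟩ := exists_path_of_reflTransGen (hb d hsnd)
  have hthin : ∀ i < k + 1 + l, i ≠ k → A.IsThinSLEdge
      (if i ≤ k then f i else g (i - (k + 1)))
      (if i + 1 ≤ k then f (i + 1) else g (i + 1 - (k + 1))) := by
    intro i hi hik
    rcases Nat.lt_or_ge i k with h | h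
    · simpa [h.le, Nat.succ_le_of_lt h] using hfs i h
    · obtain ⟨j, rfl⟩ : ∃ j, i = k + 1 + j := ⟨i - (k + 1), by omega⟩
      have := hgs j (by omega)
      have e1 : ¬ k + 1 + j ≤ k := by omega
      have e2 : ¬ k + 1 + j + 1 ≤ k := by omega
      have e3 : k + 1 + j - (k + 1) = j := by omega
      have e4 : k + 1 + j + 1 - (k + 1) = j + 1 := by omega
      rwa [if_neg e1, if_neg e2, e3, e4]
  refine ⟨k + 1 + l, fun i => if i ≤ k then f i else g (i - (k + 1)), by simp [hf0], ?_, ?_, ?_, ?_⟩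
  · have : ¬ k + 1 + l ≤ k := by omega
    simp [this, hgl]
  · intro i hi
    rcases Nat.lt_or_ge k i with h | h
    · simpa [not_le.mpr h] using up (up hb hsnd) (hgr (i - (k + 1)) (by omega))
    · simpa [h] using up ha (hfr i h)
  · intro i hi
    rcases eq_or_ne i k with rfl | h
    · right
      simpa [hfk, hg0] using hmaj
    · exact .inl (hthin i hi h)
  · intro i hi j hj h1 h2
    have e1 : i = k := by_contra fun h => h1 (hthin i hi h)
    have e2 : j = k := by_contra fun h => h2 (hthin j hj h)
    rw [e1, e2]

/-- `S` is a homomorphic image of a subalgebra of `A`. -/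
def IsFactor (A S : UAlgebra σ) : Prop :=
  ∃ ρ : A.carrier → S.carrier → Prop, (∀ s, ∃ a, ρ a s) ∧
    (∀ a s s', ρ a s → ρ a s' → s = s') ∧ Compat A S ρ

theorem IsFactor.finite [Finite A.carrier] (h : IsFactor A S) : Finite S.carrier := by
  obtain ⟨ρ, hs, hf, -⟩ := h
  choose g hg using hs
  exact Finite.of_injective g fun x y hxy => hf (g x) x y (hg x) (hxy ▸ hg y)

theorem IsFactor.idempotent (hA : A.Idempotent) (h : IsFactor A S) : S.Idempotent := by
  obtain ⟨ρ, hs, hf, hc⟩ := h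
  intro f s
  obtain ⟨a, ha⟩ := hs s
  refine hf a _ _ ?_ ha
  have := hc f (fun _ => a) (fun _ => s) fun _ => ha
  rwa [hA] at this

theorem IsFactor.of_hom {G : UAlgebra σ} (h : IsFactor A B) {φ : G.carrier → B.carrier}
    (hφ : G.IsHom B φ) {ψ : G.carrier → S.carrier} (hψ : G.IsHom S ψ)
    (hsurj : Function.Surjective ψ) (hker : ∀ x y, φ x = φ y → ψ x = ψ y) :
    IsFactor A S := by
  obtain ⟨ρ, hs, hf, hc⟩ := h
  refine ⟨fun a s => ∃ g, ρ a (φ g) ∧ ψ g = s, ?_, ?_, ?_⟩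
  · intro s
    obtain ⟨g, rfl⟩ := hsurj s
    obtain ⟨a, ha⟩ := hs (φ g)
    exact ⟨a, g, ha, rfl⟩
  · rintro a _ _ ⟨g, hg, rfl⟩ ⟨g', hg', rfl⟩
    exact hker _ _ (hf a _ _ hg hg')
  · intro f x y hxy
    choose g hg hg' using hxy
    refine ⟨G.interp f g, ?_, ?_⟩
    · rw [hφ]; exact hc f _ _ hg
    · rw [hψ, funext hg']

theorem isFactor_refl (A : UAlgebra σ) : IsFactor A A :=
  ⟨Eq, fun s => ⟨s, rfl⟩, fun _ _ _ h h' => h.symm.trans h',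
    fun f x y h => by rw [funext h]⟩

theorem isHom_quot (A : UAlgebra σ) (θ : Congruence A) :
    A.IsHom (A.quot θ) (Quotient.mk θ.toSetoid) := by
  intro f x
  apply Quotient.sound (s := θ.toSetoid)
  exact θ.compat f _ _ fun j => θ.symm (Quotient.mk_out (s := θ.toSetoid) (x j))

/-- The kernel of a homomorphism. -/
def ker {φ : A.carrier → B.carrier} (h : A.IsHom B φ) : Congruence A where
  rel x y := φ x = φ y
  refl _ := rfl
  symm h := h.symm
  trans h h' := h.trans h'
  compat f x y hxy := by rw [h, h, funext hxy]

theorem ker_isMaximal {φ : A.carrier → S.carrier} (h : A.IsHom S φ)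
    (hs : Function.Surjective φ) (hS : S.IsSimple) {a b : A.carrier} (hab : φ a ≠ φ b) :
    (ker h).IsMaximal := by
  refine ⟨fun hfull => hab (hfull a b), fun η hη hnf => ?_⟩
  have sound : ∀ {x y x' y'}, φ x = φ x' → φ y = φ y' → η.rel x y → η.rel x' y' :=
    fun e e' h => η.trans (η.symm (hη _ _ e)) (η.trans h (hη _ _ e'))
  let η' : Congruence S :=
    { rel := fun s t => ∃ x y, φ x = s ∧ φ y = t ∧ η.rel x y
      refl := fun s => by
        obtain ⟨x, rfl⟩ := hs s
        exact ⟨x, x, rfl, rfl, η.refl x⟩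
      symm := fun ⟨x, y, hx, hy, h⟩ => ⟨y, x, hy, hx, η.symm h⟩
      trans := by
        rintro _ _ _ ⟨x, y, rfl, rfl, h⟩ ⟨x', y', h1, rfl, h2⟩
        exact ⟨x, y', rfl, rfl, η.trans h (sound h1 rfl h2)⟩
      compat := by
        intro f s t hst
        choose x y hx hy hxy using hst
        exact ⟨A.interp f x, A.interp f y, by rw [h, funext hx], by rw [h, funext hy],
          η.compat f x y hxy⟩ }
  rcases hS η' with h' | h'
  · exact fun x y hxy => (h' _ _).1 ⟨x, y, rfl, rfl, hxy⟩
  · refine absurd (fun x y => ?_) hnf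
    obtain ⟨x', y', hx, hy, h⟩ := h' (φ x) (φ y)
    exact sound hx hy h

theorem quot_isSimple {θ : Congruence A} (hθ : θ.IsMaximal) : (A.quot θ).IsSimple := by
  intro η
  have hq := isHom_quot A θ
  let η' : Congruence A :=
    { rel := fun x y => η.rel (Quotient.mk θ.toSetoid x) (Quotient.mk θ.toSetoid y)
      refl := fun _ => η.refl _
      symm := fun h => η.symm h
      trans := fun h h' => η.trans h h'
      compat := fun f x y h => by
        have := η.compat f _ _ h
        rwa [← hq, ← hq] at this }
  by_cases hf : η'.IsFull
  · right
    intro x y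
    induction x using Quotient.inductionOn
    induction y using Quotient.inductionOn
    exact hf _ _
  · left
    have hle := hθ.2 η' (fun x y h => by
      have : Quotient.mk θ.toSetoid x = Quotient.mk θ.toSetoid y := Quotient.sound h
      simp only [η', this]
      exact η.refl _) hf
    intro x y
    induction x using Quotient.inductionOn
    induction y using Quotient.inductionOn
    exact ⟨fun h => Quotient.sound (hle _ _ h), fun h => h ▸ η.refl _⟩

theorem IsSetAlgebra.of_bijective {φ : A.carrier → B.carrier} (hφ : A.IsHom B φ)
    (hb : Function.Bijective φ) (hB : IsSetAlgebra B) : IsSetAlgebra A := by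
  intro n t
  obtain ⟨i, hi⟩ := hB n t
  exact ⟨i, fun x => hb.1 (by rw [hφ.eval, hi])⟩

theorem IsAffineAlgebra.of_bijective {φ : A.carrier → B.carrier} (hφ : A.IsHom B φ)
    (hb : Function.Bijective φ) (hB : IsAffineAlgebra B) : IsAffineAlgebra A := by
  obtain ⟨R, iR, fR, iG, iM, h1, t, ht⟩ := hB
  let e : A.carrier ≃ B.carrier := Equiv.ofBijective φ hb
  let iG' : AddCommGroup A.carrier := e.addCommGroup
  let iM' : Module R A.carrier := e.module R
  have hl : ∀ (n : ℕ) (c : Fin n → R) (x : Fin n → A.carrier),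
      φ (∑ i, c i • x i) = ∑ i, c i • φ (x i) := by
    intro n c x
    have := map_sum (e.linearEquiv R) (fun i => c i • x i) Finset.univ
    simp only [map_smul] at this
    exact this
  refine ⟨R, iR, fR, iG', iM', ?_, t, ?_⟩
  · intro n g
    constructor
    · rintro ⟨s, hs⟩
      obtain ⟨c, hc, hc'⟩ := (h1 n (fun y => s.eval B y)).1 ⟨s, fun _ => rfl⟩
      refine ⟨c, hc, fun x => hb.1 ?_⟩
      rw [← hs, hφ.eval, hc', hl]
    · rintro ⟨c, hc, hg⟩
      obtain ⟨s, hs⟩ := (h1 n (fun y => ∑ i, c i • y i)).2 ⟨c, hc, fun _ => rfl⟩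
      refine ⟨s, fun x => hb.1 ?_⟩
      rw [hφ.eval, hs, hg, hl]
  · intro x y z
    apply hb.1
    have h3 := hφ.b3 t x y z
    unfold UAlgebra.b3 at h3
    rw [h3, ht]
    have := map_add (e.linearEquiv R) (x - y) z
    rw [map_sub] at this
    exact this.symm

theorem IsFactor.exists_edge (h : IsFactor A S) (hS : S.IsSimple) {a b : S.carrier}
    (hab : a ≠ b) (hgen : ∀ z, Gen2 S a b z) :
    ∃ (a' b' : A.carrier) (θ : Congruence (A.Sg {a', b'}))
      (e : ((A.Sg {a', b'}).quot θ).carrier → S.carrier), a' ≠ b' ∧ θ.IsMaximal ∧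
      ((A.Sg {a', b'}).quot θ).IsHom S e ∧ Function.Bijective e ∧
      e (A.qa a' b' θ) = a ∧ e (A.qb a' b' θ) = b := by
  obtain ⟨ρ, hs, hf, hc⟩ := h
  obtain ⟨a', ha'⟩ := hs a
  obtain ⟨b', hb'⟩ := hs b
  have hex : ∀ g : (A.Sg {a', b'}).carrier, ∃ s, ρ g.1 s := by
    rintro ⟨g, hg⟩
    obtain ⟨t, rfl⟩ := (gen2_iff_closureSet _ _ _).2 hg
    exact ⟨_, hc.b2 t ha' hb'⟩
  choose φ hφ using hex
  have hhom : (A.Sg {a', b'}).IsHom S φ := fun f x => hf _ _ _ (hφ _) (hc f _ _ fun j => hφ (x j))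
  have hsurj : Function.Surjective φ := by
    intro s
    obtain ⟨t, rfl⟩ := hgen s
    have hg : A.b2 t a' b' ∈ A.ClosureSet {a', b'} := (gen2_iff_closureSet _ _ _).1 ⟨t, rfl⟩
    exact ⟨⟨_, hg⟩, hf _ _ _ (hφ ⟨_, hg⟩) (hc.b2 t ha' hb')⟩
  have ea : φ (A.sgA a' b') = a := hf _ _ _ (hφ (A.sgA a' b')) ha'
  have eb : φ (A.sgB a' b') = b := hf _ _ _ (hφ (A.sgB a' b')) hb'
  let e : ((A.Sg {a', b'}).quot (ker hhom)).carrier → S.carrier :=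
    Quotient.lift φ fun _ _ h => h
  refine ⟨a', b', ker hhom, e, ?_, ker_isMaximal hhom hsurj hS (a := A.sgA a' b')
    (b := A.sgB a' b') (by rwa [ea, eb]), ?_, ⟨?_, ?_⟩, ea, eb⟩
  · rintro rfl
    exact hab (hf _ _ _ ha' hb')
  · intro f x
    change φ _ = _
    rw [hhom]
    congr 1
    funext j
    exact congrArg e (Quotient.out_eq (s := (ker hhom).toSetoid) (x j))
  · intro x y
    induction x using Quotient.inductionOn
    induction y using Quotient.inductionOn
    exact fun h => Quotient.sound h
  · intro s
    obtain ⟨x, rfl⟩ := hsurj s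
    exact ⟨Quotient.mk _ x, rfl⟩

theorem IsFactor.not_isSetAlgebra (h1 : A.OmitsType1) (h : IsFactor A S) (hS : S.IsSimple)
    {a b : S.carrier} (hab : a ≠ b) (hgen : ∀ z, Gen2 S a b z) : ¬ IsSetAlgebra S := by
  intro hset
  have hcl : A.IsClosed Set.univ := fun _ _ _ => trivial
  have h' : IsFactor (A.subalg Set.univ hcl) S := by
    obtain ⟨ρ, hs, hf, hc⟩ := h
    refine ⟨fun x s => ρ x.1 s, fun s => ?_, fun x => hf x.1, fun f x y hxy => hc f _ _ hxy⟩
    obtain ⟨x, hx⟩ := hs s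
    exact ⟨⟨x, trivial⟩, hx⟩
  obtain ⟨a', b', θ, e, hne, hmax, he, hbij, -, -⟩ := h'.exists_edge hS hab hgen
  exact h1 _ hcl a' b' ⟨hne, θ, hmax, hset.of_bijective he hbij⟩

theorem IsFactor.not_isAffineAlgebra (haf : A.AffineFree) (h : IsFactor A S) (hS : S.IsSimple)
    {a b : S.carrier} (hab : a ≠ b) (hgen : ∀ z, Gen2 S a b z) : ¬ IsAffineAlgebra S := by
  intro haff
  obtain ⟨a', b', θ, e, hne, hmax, he, hbij, -, -⟩ := h.exists_edge hS hab hgen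
  exact haf a' b' ⟨hne, θ, hmax, haff.of_bijective he hbij⟩

theorem IsFactor.eq_or_eq_of_majority (hsm : A.IsSmooth) (hid : A.Idempotent)
    (h : IsFactor A S) (hS : S.IsSimple)
    {a b : S.carrier} (hab : a ≠ b) (hgen : ∀ z, Gen2 S a b z)
    (hmaj : R3 (sq S) (a, b) (b, a) (a, b) (a, b) (a, b)) (z : S.carrier) : z = a ∨ z = b := by
  have hSid := h.idempotent hid
  obtain ⟨a', b', θ, e, hne, hmax, he, hbij, ea, eb⟩ := h.exists_edge hS hab hgen
  obtain ⟨p, hp1, hp2, hp3⟩ := hmaj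
  simp only [b3_pr, Prod.mk.injEq] at hp1 hp2 hp3
  have hM : IsMajorityOn (fun x y z => p.eval ((A.Sg {a', b'}).quot θ) ![x, y, z])
      {A.qa a' b' θ, A.qb a' b' θ} := by
    have key : ∀ x y z, e (p.eval ((A.Sg {a', b'}).quot θ) ![x, y, z]) =
        S.b3 p (e x) (e y) (e z) := fun x y z => he.b3 p x y z
    rintro x (rfl | rfl) y (rfl | rfl) <;> refine ⟨hbij.1 ?_, hbij.1 ?_, hbij.1 ?_⟩ <;>
      simp only [key, ea, eb, hSid.b3, hp1, hp2, hp3]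
  have hcl := hsm a' b' θ (by
    by_cases hsl : ∃ t : Term σ 2,
      IsSemilatticeOn (fun x y => t.eval ((A.Sg {a', b'}).quot θ) ![x, y])
        {A.qa a' b' θ, A.qb a' b' θ}
    · exact .inl ⟨hmax, hsl⟩
    · exact .inr ⟨hmax, ⟨p, hM⟩, hsl⟩)
  obtain ⟨w, rfl⟩ := hbij.2 z
  induction w using Quotient.inductionOn with
  | h w =>
    obtain ⟨w, hw⟩ := w
    have hmem : w ∈ A.edgeBlockUnion a' b' θ :=
      ((gen2_iff_closureSet _ _ _).2 hw).closed hcl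
        ⟨(A.sgA a' b').2, .inl (θ.refl _)⟩ ⟨(A.sgB a' b').2, .inr (θ.refl _)⟩
    obtain ⟨_, h' | h'⟩ := hmem
    · left; rw [← ea]; exact congrArg e (Quotient.sound h')
    · right; rw [← eb]; exact congrArg e (Quotient.sound h')

end UAlgebra

end Factors

section Simple

variable {σ : Signature}

namespace UAlgebra

variable {S : UAlgebra σ}

/-- The properties of a simple factor of a smooth affine-free algebra omitting the unary type
that are used to find majority terms, together with an inductive hypothesis. -/
structure Good (S : UAlgebra σ) : Prop where
  fin : Finite S.carrier
  idem : S.Idempotent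
  simple : S.IsSimple
  notset : ¬ IsSetAlgebra S
  notaff : ¬ IsAffineAlgebra S
  maj2 : ∀ p : S.carrier × S.carrier, p.1 ≠ p.2 → (∀ z, Gen2 S p.1 p.2 z) →
    R3 (sq S) p p.swap p p p → ∀ z, z = p.1 ∨ z = p.2
  ih : ∀ p z : S.carrier × S.carrier, size S p.1 z.1 < Nat.card S.carrier →
    size S p.2 z.2 < Nat.card S.carrier → W2 (sq S) (p, z)

/-- A generating pair of distinct elements that is maximal with respect to steps. -/
structure Stable (S : UAlgebra σ) (p : S.carrier × S.carrier) : Prop where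
  ne : p.1 ≠ p.2
  gen : ∀ z, Gen2 S p.1 p.2 z
  max : LRmax S p

/-- The subalgebra of the square generated by a pair and its transpose. -/
def T (S : UAlgebra σ) (p : S.carrier × S.carrier) (x y : S.carrier) : Prop :=
  Gen2 (sq S) p p.swap (x, y)

/-- Reachability by thin semilattice edges. -/
def Up (S : UAlgebra σ) : S.carrier → S.carrier → Prop := Relation.ReflTransGen (Th S)

/-- An element from which no generating pair with a component of an ascent of `p` is
reachable. -/
def GoodElt (S : UAlgebra σ) (p : S.carrier × S.carrier) (c : S.carrier) : Prop :=
  ∀ k, LR S p k → ∀ d, Up S c d →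
    size S k.1 d < Nat.card S.carrier ∧ size S k.2 d < Nat.card S.carrier

theorem gen2_self (hS : S.Idempotent) {x z : S.carrier} (h : Gen2 S x x z) : z = x := by
  obtain ⟨s, rfl⟩ := h
  exact hS.b2 s x

theorem Stable.of_LR (hS : S.Idempotent) {p q : S.carrier × S.carrier} (hp : Stable S p)
    (h : LR S p q) : Stable S q := by
  have hg : ∀ z, Gen2 S q.1 q.2 z := fun z => (hp.max q h).gen (hp.gen z)
  refine ⟨fun he => hp.ne ?_, hg, hp.max.of_LR h⟩
  rw [← he] at hg
  rw [gen2_self hS (hg p.1), gen2_self hS (hg p.2)]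

theorem LRmax.swap {p : S.carrier × S.carrier} (h : LRmax S p) : LRmax S p.swap :=
  fun q hq => (h q.swap hq.swap).swap

theorem Stable.swap {p : S.carrier × S.carrier} (hp : Stable S p) : Stable S p.swap :=
  ⟨hp.ne.symm, fun z => (hp.gen z).symm, hp.max.swap⟩

theorem t_symm {p : S.carrier × S.carrier} {x y : S.carrier} (h : T S p x y) : T S p y x :=
  (Gen2.hom (isHom_swap (A := S) (B := S)) h).symm

theorem t_swap {p : S.carrier × S.carrier} {x y : S.carrier} (h : T S p x y) :
    T S p.swap x y := Gen2.symm h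

theorem t_self (p : S.carrier × S.carrier) : T S p p.1 p.2 := Gen2.left _ _

theorem Stable.t_total {p : S.carrier × S.carrier} (hp : Stable S p) (x : S.carrier) :
    ∃ y, T S p x y := by
  obtain ⟨s, hs⟩ := hp.gen x
  exact ⟨b2 S s p.2 p.1, s, by simp [hs]⟩

theorem LR.t {p q : S.carrier × S.carrier} (h : LR S p q) {x y : S.carrier}
    (ht : T S q x y) : T S p x y := h.sq.gen ht

theorem t_compat (p : S.carrier × S.carrier) : Compat S S (T S p) := by
  intro f x y h
  exact gen2_isClosed (A := sq S) p p.swap f (fun j => (x j, y j)) h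

theorem Stable.not_t_right (hS : S.Idempotent) {p : S.carrier × S.carrier} (hp : Stable S p) :
    ¬ T S p p.2 p.2 := by
  intro h
  have h' := h
  obtain ⟨s, hs⟩ := h'
  simp only [b2_pr, Prod.fst_swap, Prod.snd_swap, Prod.mk.injEq] at hs
  have hstep : Step S p (p.2, p.2) := ⟨h, s, by simp [hs, hS.b2], by simp [hs, hS.b2]⟩
  exact (hp.of_LR hS (.single hstep)).ne rfl

theorem Stable.not_t_left (hS : S.Idempotent) {p : S.carrier × S.carrier} (hp : Stable S p) :
    ¬ T S p p.1 p.1 := fun h => hp.swap.not_t_right hS (t_swap h)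

theorem Stable.not_t (hS : S.Idempotent) {p k : S.carrier × S.carrier} (hp : Stable S p)
    (hk : LR S p k) : ¬ T S p k.1 k.1 ∧ ¬ T S p k.2 k.2 :=
  ⟨fun h => (hp.of_LR hS hk).not_t_left hS ((hp.max k hk).t h),
    fun h => (hp.of_LR hS hk).not_t_right hS ((hp.max k hk).t h)⟩

theorem Stable.mem_of_absorbing [Finite S.carrier] (hS : S.Idempotent)
    {p : S.carrier × S.carrier} (hp : Stable S p) {D : Set S.carrier} (hD : S.IsClosed D)
    (hne : D.Nonempty) (q : Term σ 2) (hq : ∀ d ∈ D, ∀ x, b2 S q x d ∈ D ∧ b2 S q d x ∈ D)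
    (z : S.carrier) : z ∈ D := by
  obtain ⟨d, hd⟩ := hne
  obtain ⟨d', hdd⟩ := hp.t_total d
  have hD2 : (sq S).IsClosed {u | u.1 ∈ D ∧ u.2 ∈ D} :=
    fun f x hx => ⟨hD f _ fun j => (hx j).1, hD f _ fun j => (hx j).2⟩
  obtain ⟨r, hr, hg, hth⟩ := exists_th_of_absorbing (hS.pr hS) p hD2
    (r := (b2 S q d d', b2 S q d' d)) ⟨(hq d hd d').2, (hq d hd d').1⟩ q
    fun e he => by simp [hq _ he.1, hq _ he.2]
  have hg' : Gen2 (sq S) p p.swap (b2 S q d d', b2 S q d' d) := by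
    have := Gen2.b2 q hdd (t_symm hdd)
    rwa [b2_pr] at this
  have hst := hp.of_LR hS (.single ⟨(Gen2.left _ _).trans hg' hg, hth⟩)
  exact (hst.gen z).closed hD hr.1 hr.2

theorem nbhd_isClosed (hS : S.Idempotent) {U : S.carrier → S.carrier → Prop}
    (hU : Compat S S U) (x : S.carrier) : S.IsClosed {y | U x y} := by
  intro f y hy
  have := hU f (fun _ => x) y hy
  rwa [hS] at this

theorem Stable.forall_of_up [Finite S.carrier] (hS : S.Idempotent)
    {p : S.carrier × S.carrier} (hp : Stable S p) {U : S.carrier → S.carrier → Prop}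
    (hU : Compat S S U) (htot : ∀ x, ∃ y, U x y) {x y : S.carrier} (hx : ∀ z, U x z)
    (h : Up S x y) : ∀ z, U y z := by
  induction h with
  | refl => exact hx
  | @tail y y' _ h ih =>
    obtain ⟨t, h1, h2⟩ := h
    refine hp.mem_of_absorbing hS (nbhd_isClosed hS hU y') (htot y') t fun d hd e => ⟨?_, ?_⟩
    · have := hU.b2 t (ih e) hd
      rwa [h1] at this
    · have := hU.b2 t hd (ih e)
      rwa [h2] at this

theorem size_lt_card [Finite S.carrier] {x y z : S.carrier} (h : ¬ Gen2 S x y z) :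
    size S x y < Nat.card S.carrier := by
  rw [← Set.ncard_univ]
  exact Set.ncard_lt_ncard ⟨Set.subset_univ _, fun h' => h (h' (Set.mem_univ z))⟩
    (Set.toFinite _)

theorem gen2_of_card_le [Finite S.carrier] {x y : S.carrier}
    (h : ¬ size S x y < Nat.card S.carrier) (z : S.carrier) : Gen2 S x y z :=
  by_contra fun h' => h (size_lt_card h')

theorem Stable.goodElt_of_center [Finite S.carrier] (hS : S.Idempotent)
    {p : S.carrier × S.carrier} (hp : Stable S p) {U : S.carrier → S.carrier → Prop}
    (hU : Compat S S U) (hsymm : ∀ x y, U x y → U y x) (htot : ∀ x, ∃ y, U x y)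
    (hk : ∀ k, LR S p k → (∃ y, U k.1 y ∧ ∃ z, ¬ U y z) ∧ (∃ y, U k.2 y ∧ ∃ z, ¬ U y z))
    {c : S.carrier} (hc : ∀ z, U c z) : GoodElt S p c := by
  intro k hpk d hd
  have hd' := hp.forall_of_up hS hU htot hc hd
  obtain ⟨⟨y, hy, z, hz⟩, ⟨y', hy', z', hz'⟩⟩ := hk k hpk
  exact ⟨size_lt_card fun h => hz (h.closed (nbhd_isClosed hS hU y) (hsymm _ _ hy)
      (hsymm _ _ (hd' y))),
    size_lt_card fun h => hz' (h.closed (nbhd_isClosed hS hU y') (hsymm _ _ hy')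
      (hsymm _ _ (hd' y')))⟩

theorem Stable.forall_of_nbr (hS : S.Idempotent)
    {p : S.carrier × S.carrier} (hp : Stable S p) {U : S.carrier → S.carrier → Prop}
    (hU : Compat S S U) {x : S.carrier} (h1 : U x p.1) (h2 : U x p.2) (z : S.carrier) : U x z :=
  (hp.gen z).closed (nbhd_isClosed hS hU x) h1 h2

theorem Stable.forall_of_center (hS : S.Idempotent)
    {p : S.carrier × S.carrier} (hp : Stable S p) {U : S.carrier → S.carrier → Prop}
    (hU : Compat S S U) (hsymm : ∀ x y, U x y → U y x) (h1 : ∀ z, U p.1 z) (h2 : ∀ z, U p.2 z)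
    (x z : S.carrier) : U x z :=
  hp.forall_of_nbr hS hU (hsymm _ _ (h1 x)) (hsymm _ _ (h2 x)) z

theorem Stable.not_tol (hS : S.Idempotent)
    {p : S.carrier × S.carrier} (hp : Stable S p) {U : S.carrier → S.carrier → Prop}
    (hU : Compat S S U) (hrefl : ∀ x, U x x) (hsymm : ∀ x y, U x y → U y x)
    (hprop : ∃ x y, ¬ U x y) : ¬ U p.1 p.2 := by
  intro h
  obtain ⟨x, y, hxy⟩ := hprop
  exact hxy (hp.forall_of_center hS hU hsymm (hp.forall_of_nbr hS hU (hrefl _) h)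
    (hp.forall_of_nbr hS hU (hsymm _ _ h) (hrefl _)) x y)

theorem Stable.goodElt_of_tol [Finite S.carrier] (hS : S.Idempotent)
    {p : S.carrier × S.carrier} (hp : Stable S p) {U : S.carrier → S.carrier → Prop}
    (hU : Compat S S U) (hrefl : ∀ x, U x x) (hsymm : ∀ x y, U x y → U y x)
    (hprop : ∃ x y, ¬ U x y) {c : S.carrier} (hc : ∀ z, U c z) : GoodElt S p c := by
  refine hp.goodElt_of_center hS hU hsymm (fun x => ⟨x, hrefl x⟩) (fun k hk => ?_) hc
  have h := (hp.of_LR hS hk).not_tol hS hU hrefl hsymm hprop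
  exact ⟨⟨k.1, hrefl _, k.2, h⟩, ⟨k.2, hrefl _, k.1, fun h' => h (hsymm _ _ h')⟩⟩

/-- Relational powers. -/
def pw {α : Type*} (U : α → α → Prop) : ℕ → α → α → Prop
  | 0 => Eq
  | k + 1 => Relation.Comp (pw U k) U

theorem pw_one {α : Type*} (U : α → α → Prop) {x y : α} : pw U 1 x y ↔ U x y :=
  ⟨fun ⟨_, h, h'⟩ => by cases h; exact h', fun h => ⟨x, rfl, h⟩⟩

theorem pw_add {α : Type*} (U : α → α → Prop) (k l : ℕ) {x z : α} :
    pw U (k + l) x z ↔ ∃ y, pw U k x y ∧ pw U l y z := by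
  induction l generalizing z with
  | zero => exact ⟨fun h => ⟨z, h, rfl⟩, fun ⟨_, h, h'⟩ => by cases h'; exact h⟩
  | succ l ih =>
    constructor
    · rintro ⟨w, h, h'⟩
      obtain ⟨y, h1, h2⟩ := ih.1 h
      exact ⟨y, h1, w, h2, h'⟩
    · rintro ⟨y, h1, w, h2, h'⟩
      exact ⟨w, ih.2 ⟨y, h1, h2⟩, h'⟩

theorem pw_symm {α : Type*} {U : α → α → Prop} (hU : ∀ x y, U x y → U y x) (k : ℕ) :
    ∀ x y, pw U k x y → pw U k y x := by
  induction k with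
  | zero => exact fun x y h => h.symm
  | succ k ih =>
    rintro x y ⟨z, h1, h2⟩
    rw [add_comm, pw_add]
    exact ⟨z, (pw_one U).2 (hU _ _ h2), ih _ _ h1⟩

theorem pw_refl {α : Type*} {U : α → α → Prop} (hU : ∀ x, U x x) (k : ℕ) (x : α) :
    pw U k x x := by
  induction k with
  | zero => rfl
  | succ k ih => exact ⟨x, ih, hU x⟩

theorem pw_compat {U : S.carrier → S.carrier → Prop} (hU : Compat S S U) (k : ℕ) :
    Compat S S (pw U k) := by
  induction k with
  | zero => intro f x y h; rw [funext h]; rfl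
  | succ k ih =>
    intro f x y h
    choose z h1 h2 using h
    exact ⟨_, ih f x z h1, hU f z y h2⟩

theorem pw_even_odd {α : Type*} {U : α → α → Prop} {x y : α} (h1 : U x y) (h2 : U y x)
    (k : ℕ) : pw U (2 * k) x x ∧ pw U (2 * k + 1) x y := by
  induction k with
  | zero => exact ⟨rfl, (pw_one U).2 h1⟩
  | succ k ih =>
    have h : pw U (2 * (k + 1)) x x := ⟨y, ih.2, h2⟩
    exact ⟨h, x, h, h1⟩

theorem exists_pw_of_tol (hS : S.IsSimple) {U : S.carrier → S.carrier → Prop}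
    (hU : Compat S S U) (hrefl : ∀ x, U x x) (hsymm : ∀ x y, U x y → U y x)
    {u v : S.carrier} (huv : U u v) (hne : u ≠ v) (x y : S.carrier) : ∃ k, pw U k x y := by
  have mono : ∀ {k l x y}, k ≤ l → pw U k x y → pw U l x y := by
    intro k l x y hkl h
    obtain ⟨m, rfl⟩ := Nat.exists_eq_add_of_le hkl
    exact (pw_add U k m).2 ⟨y, h, pw_refl hrefl m y⟩
  let θ : Congruence S :=
    { rel := fun x y => ∃ k, pw U k x y
      refl := fun x => ⟨0, rfl⟩
      symm := fun ⟨k, h⟩ => ⟨k, pw_symm hsymm k _ _ h⟩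
      trans := fun ⟨k, h⟩ ⟨l, h'⟩ => ⟨k + l, (pw_add U k l).2 ⟨_, h, h'⟩⟩
      compat := fun f x y h => by
        choose k hk using h
        exact ⟨Finset.univ.sup k, pw_compat hU _ f x y fun j =>
          mono (Finset.le_sup (Finset.mem_univ j)) (hk j)⟩ }
  rcases hS θ with h | h
  · exact absurd ((h u v).1 ⟨1, (pw_one U).2 huv⟩) hne
  · exact h x y

theorem Stable.exists_goodElt [Finite S.carrier] (hS : S.Idempotent) (hsimp : S.IsSimple)
    {p : S.carrier × S.carrier} (hp : Stable S p) {U : S.carrier → S.carrier → Prop}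
    (hU : Compat S S U) (hrefl : ∀ x, U x x) (hsymm : ∀ x y, U x y → U y x)
    (hprop : ∃ x y, ¬ U x y) {u v : S.carrier} (huv : U u v) (hne : u ≠ v) :
    ∃ c, GoodElt S p c := by
  classical
  have hex := exists_pw_of_tol hsimp hU hrefl hsymm huv hne p.1 p.2
  obtain ⟨k, hk, hmin⟩ : ∃ k, pw U k p.1 p.2 ∧ ∀ l < k, ¬ pw U l p.1 p.2 :=
    ⟨Nat.find hex, Nat.find_spec hex, fun l hl => Nat.find_min hex hl⟩
  match k, hk, hmin with
  | 0, hk, _ => exact absurd hk hp.ne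
  | 1, hk, _ => exact absurd ((pw_one U).1 hk) (hp.not_tol hS hU hrefl hsymm hprop)
  | k + 2, ⟨x, h1, h2⟩, hmin =>
    have h2' : pw U (k + 1) x p.2 := ⟨x, pw_refl hrefl k x, h2⟩
    have hs := pw_symm hsymm (k + 1)
    exact ⟨x, hp.goodElt_of_tol hS (pw_compat hU (k + 1)) (pw_refl hrefl (k + 1)) hs
      ⟨p.1, p.2, hmin _ (Nat.lt_succ_self _)⟩
      (hp.forall_of_nbr hS (pw_compat hU (k + 1)) (hs _ _ h1) h2')⟩

theorem lr_of_sq {p z p' z' : S.carrier × S.carrier} (hp : LRmax S p)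
    (hz : T S p z.1 z.2) (h : LR (sq S) (p, z) (p', z')) : LR S p p' ∧ T S p z'.1 z'.2 := by
  suffices ∀ q, LR (sq S) (p, z) q → LR S p q.1 ∧ T S p q.2.1 q.2.2 from this _ h
  intro q hq
  induction hq with
  | refl => exact ⟨.refl, hz⟩
  | @tail q r _ h ih =>
    obtain ⟨h1, h2⟩ := ih
    have hq1 : Gen2 (sq S) p p.swap q.1 := h1.t (t_self _)
    have g1 : Gen2 (sq S) p p.swap r.1 := hq1.trans h2 (h.1.hom isHom_fst)
    have g2 : Gen2 (sq S) p p.swap r.2 := Gen2.trans h2 hq1 (h.1.hom isHom_snd)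
    exact ⟨h1.tail ⟨(hp q.1 h1).t g1, h.2.hom isHom_fst⟩, g2⟩

theorem lr_up_snd {p z p' z' : S.carrier × S.carrier} (h : LR (sq S) (p, z) (p', z')) :
    Up S z.1 z'.1 ∧ Up S z.2 z'.2 ∧ Up S p.1 p'.1 ∧ Up S p.2 p'.2 :=
  ⟨Relation.ReflTransGen.lift (fun q : (S.carrier × S.carrier) × S.carrier × S.carrier => q.2.1)
      (fun _ _ h => (h.2.hom isHom_snd).hom isHom_fst) _ _ h,
    Relation.ReflTransGen.lift (fun q : (S.carrier × S.carrier) × S.carrier × S.carrier => q.2.2)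
      (fun _ _ h => (h.2.hom isHom_snd).hom isHom_snd) _ _ h,
    Relation.ReflTransGen.lift (fun q : (S.carrier × S.carrier) × S.carrier × S.carrier => q.1.1)
      (fun _ _ h => (h.2.hom isHom_fst).hom isHom_fst) _ _ h,
    Relation.ReflTransGen.lift (fun q : (S.carrier × S.carrier) × S.carrier × S.carrier => q.1.2)
      (fun _ _ h => (h.2.hom isHom_fst).hom isHom_snd) _ _ h⟩

theorem W2.exists_term {A : UAlgebra σ} {x y : A.carrier} (h : W2 A (x, y)) :
    ∃ (x' y' : A.carrier) (w : Term σ 3), LR A (x, y) (x', y') ∧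
      b3 A w x x y = x' ∧ b3 A w x y x = x' ∧ b3 A w y x x = x' ∧
      b3 A w y y x = y' ∧ b3 A w y x y = y' ∧ b3 A w x y y = y' := by
  obtain ⟨⟨x', y'⟩, hc, w, h1, h2, h3⟩ := h
  simp only [b3_pr, Prod.swap_prod_mk, Prod.mk.injEq] at h1 h2 h3
  exact ⟨x', y', w, hc, h1.1, h2.1, h3.1, h1.2, h2.2, h3.2⟩

theorem R3.t {p u v w : S.carrier × S.carrier} (h : R3 (sq S) p p.swap u v w) :
    T S p w.1 w.2 := by
  obtain ⟨r, -, -, h3⟩ := h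
  exact ⟨c3 r p1 p0 p0, by simp only [b2_c3, b2_p0, b2_p1]; exact h3⟩

theorem Good.w2_of_r3 (hG : Good S) {p k z : S.carrier × S.carrier} (hp : Stable S p)
    (hk : LR S p k) (hr : R3 (sq S) k k.swap k k z)
    (h1 : size S k.1 z.1 < Nat.card S.carrier) (h2 : size S k.2 z.2 < Nat.card S.carrier) :
    W2 S p := by
  refine W2.of_LR hG.idem hk ?_
  obtain ⟨k', z', w, hl, e1, e2, e3, -⟩ := (hG.ih k z h1 h2).exists_term
  refine ⟨k', (lr_of_sq (hp.max.of_LR hk) hr.t hl).1, ?_⟩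
  have := R3.b3 w hr hr.swap23 hr.swap23.swap12
  rwa [e1, e2, e3] at this

theorem T.r3 (hS : S.Idempotent) {p z : S.carrier × S.carrier} (h : T S p z.1 z.2) :
    R3 (sq S) p p.swap p z z.swap := by
  obtain ⟨s, hs⟩ := h
  have hs' := congrArg Prod.swap hs
  have h2 : (sq S).IsHom (sq S) Prod.swap := isHom_swap
  rw [h2.b2] at hs'
  have := R3.b2 s (r3_gen (A := sq S) p p.swap) (r3_gen (A := sq S) p p.swap).swap23
  rw [(hS.pr hS).b2, hs] at this
  rw [Prod.swap_swap] at hs'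
  rwa [hs'] at this

theorem Good.w2_of_t (hG : Good S) {p z : S.carrier × S.carrier} (hp : Stable S p)
    (hz : T S p z.1 z.2)
    (h1 : size S p.1 z.1 < Nat.card S.carrier) (h2 : size S p.2 z.2 < Nat.card S.carrier)
    (h3 : ∀ k, LR S p k → Gen2 S p.1 z.1 k.1 → ∀ c d, Up S z.1 c → Up S z.2 d →
      size S k.1 d < Nat.card S.carrier ∧ size S k.2 c < Nat.card S.carrier) :
    W2 S p := by
  obtain ⟨k, y, w, hl, e1, e2, e3, e4, e5, e6⟩ := (hG.ih p z h1 h2).exists_term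
  obtain ⟨hk, -⟩ := lr_of_sq hp.max hz hl
  have hr := hz.r3 hG.idem
  have hs := congrArg Prod.swap e4
  have h2 : (sq S).IsHom (sq S) Prod.swap := isHom_swap
  rw [h2.b3] at hs
  have := R3.b3 w hr hr.swap12 (r3_gen (A := sq S) p p.swap)
  rw [e2, e3, hs] at this
  have hup := lr_up_snd hl
  have hg : Gen2 S p.1 z.1 k.1 :=
    (hl.gen (Gen2.left k y)).hom (isHom_fst (A := S) (B := S))
  have h4 := h3 k hk hg _ _ hup.1 hup.2.1
  exact hG.w2_of_r3 hp hk ((hp.max k hk).r3_sq hG.idem this) h4.1 h4.2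

theorem Good.w2_of_goodElt (hG : Good S) {p : S.carrier × S.carrier} (hp : Stable S p)
    {c d : S.carrier} (ht : T S p c d) (hc : GoodElt S p c) (hd : GoodElt S p d) : W2 S p :=
  hG.w2_of_t hp (z := (c, d)) ht (hc p .refl c .refl).1 (hd p .refl d .refl).2
    fun k hk _ _ _ h1 h2 => ⟨(hd k hk _ h2).1, (hc k hk _ h1).2⟩

theorem Good.w2_of_linked (hG : Good S) {p : S.carrier × S.carrier} (hp : Stable S p)
    {x u v : S.carrier} (hu : T S p x u) (hv : T S p x v) (huv : u ≠ v) : W2 S p := by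
  classical
  have hfin := hG.fin
  have hS := hG.idem
  have hsy : ∀ x y, T S p x y → T S p y x := fun _ _ => t_symm
  have hU := fun k => pw_compat (t_compat (S := S) p) k
  have hUs := fun k => pw_symm hsy k
  have hT : ∀ k, LR S p k → T S p k.1 k.2 := fun k hk => hk.t (t_self k)
  have hUt : ∀ k x, ∃ y, pw (T S p) k x y := by
    intro k x
    induction k with
    | zero => exact ⟨x, rfl⟩
    | succ k ih =>
      obtain ⟨y, hy⟩ := ih
      obtain ⟨z, hz⟩ := hp.t_total y
      exact ⟨z, y, hy, hz⟩
  have hUr : ∀ k x, pw (T S p) (2 * k) x x := by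
    intro k x
    obtain ⟨y, hy⟩ := hp.t_total x
    exact (pw_even_odd hy (hsy _ _ hy) k).1
  by_cases hA : ∃ c, T S p p.1 c ∧ T S p c p.2
  · obtain ⟨c, h1, h2⟩ := hA
    have hc := hp.forall_of_nbr hS (t_compat p) (hsy _ _ h1) h2
    have hg : GoodElt S p c := hp.goodElt_of_center hS (t_compat p) hsy hp.t_total
      (fun k hk => ⟨⟨k.2, hT k hk, k.2, (hp.not_t hS hk).2⟩,
        ⟨k.1, hsy _ _ (hT k hk), k.1, (hp.not_t hS hk).1⟩⟩) hc
    exact hG.w2_of_goodElt hp (hc c) hg hg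
  · have hex : ∃ m, ∃ k, LR S p k ∧ (pw (T S p) (2 * m + 1) k.1 k.1 ∨
        pw (T S p) (2 * m + 1) k.2 k.2) := by
      have hev : ∀ m x y, pw (pw (T S p) 2) m x y → pw (T S p) (2 * m) x y := by
        intro m
        induction m with
        | zero => exact fun _ _ h => h
        | succ m ih =>
          rintro x y ⟨z, h1, h2⟩
          exact (pw_add _ (2 * m) 2).2 ⟨z, ih _ _ h1, h2⟩
      obtain ⟨m, hm⟩ := exists_pw_of_tol hG.simple (hU 2) (hUr 1) (hUs 2) (u := u) (v := v)
        ⟨x, (pw_one _).2 (hsy _ _ hu), hv⟩ huv p.1 p.2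
      exact ⟨m, p, .refl, .inl ⟨p.2, hev _ _ _ hm, hsy _ _ (t_self p)⟩⟩
    obtain ⟨m, ⟨k, hk, hodd⟩, hmin⟩ : ∃ m, (∃ k, LR S p k ∧ (pw (T S p) (2 * m + 1) k.1 k.1 ∨
        pw (T S p) (2 * m + 1) k.2 k.2)) ∧ ∀ l < m, ∀ k, LR S p k →
          ¬ pw (T S p) (2 * l + 1) k.1 k.1 ∧ ¬ pw (T S p) (2 * l + 1) k.2 k.2 :=
      ⟨Nat.find hex, Nat.find_spec hex, fun l hl k hk => by
        have := Nat.find_min hex hl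
        push Not at this
        exact this k hk⟩
    have hm : m ≠ 0 := by
      rintro rfl
      rcases hodd with h | h
      · exact (hp.not_t hS hk).1 ((pw_one _).1 h)
      · exact (hp.not_t hS hk).2 ((pw_one _).1 h)
    have hst := hp.of_LR hS hk
    obtain ⟨c, d, hcd, hc, hd⟩ : ∃ c d, T S p c d ∧ (∀ z, pw (T S p) (m + 1) c z) ∧
        ∀ z, pw (T S p) (m + 1) d z := by
      have key : ∀ a b, T S p a b → (∀ e, pw (T S p) (m + 1) e a → pw (T S p) (m + 1) e b →
          ∀ z, pw (T S p) (m + 1) e z) → pw (T S p) (2 * m + 1) a a →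
          ∃ c d, T S p c d ∧ (∀ z, pw (T S p) (m + 1) c z) ∧ ∀ z, pw (T S p) (m + 1) d z := by
        intro a b hab hall haa
        rw [show 2 * m + 1 = m + 1 + m by ring] at haa
        obtain ⟨d, ⟨c, h1, h2⟩, h3⟩ := (pw_add _ (m + 1) m).1 haa
        refine ⟨c, d, h2, hall c ?_ ⟨a, hUs _ _ _ h1, hab⟩, hall d ?_ ⟨a, h3, hab⟩⟩
        · rw [add_comm m 1]
          exact (pw_add _ 1 m).2 ⟨d, (pw_one _).2 h2, h3⟩
        · rw [add_comm m 1]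
          exact (pw_add _ 1 m).2 ⟨c, (pw_one _).2 (hsy _ _ h2), hUs _ _ _ h1⟩
      rcases hodd with h | h
      · exact key _ _ (hT k hk) (fun e h1 h2 => hst.forall_of_nbr hS (hU _) h1 h2) h
      · exact key _ _ (hsy _ _ (hT k hk)) (fun e h1 h2 => hst.forall_of_nbr hS (hU _) h2 h1) h
    have hgood : ∀ c, (∀ z, pw (T S p) (m + 1) c z) → GoodElt S p c := by
      intro c hc
      rcases Nat.even_or_odd' m with ⟨l, hl | hl⟩
      · refine hp.goodElt_of_center hS (hU _) (hUs _) (hUt _) (fun k hk => ?_) hc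
        have h1 := (pw_even_odd (hT k hk) (hsy _ _ (hT k hk)) l).2
        have h2 := (pw_even_odd (hsy _ _ (hT k hk)) (hT k hk) l).2
        have h3 := hmin l (by omega) k hk
        rw [← hl] at h1 h2 h3
        exact ⟨⟨k.2, h1, k.2, h3.2⟩, ⟨k.1, h2, k.1, h3.1⟩⟩
      · have e : m + 1 = 2 * (l + 1) := by omega
        rw [e] at hc
        refine hp.goodElt_of_tol hS (hU _) (hUr _) (hUs _) ⟨p.1, p.2, fun h => ?_⟩ hc
        rcases Nat.eq_zero_or_pos l with rfl | hl0
        · obtain ⟨y, h1, h2⟩ := h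
          exact hA ⟨y, (pw_one _).1 h1, h2⟩
        · exact (hmin (l + 1) (by omega) p .refl).1 ⟨p.2, h, hsy _ _ (t_self p)⟩
    exact hG.w2_of_goodElt hp hcd (hgood c hc) (hgood d hd)

end UAlgebra

end Simple

section Functional

variable {σ : Signature}

namespace UAlgebra

variable {S : UAlgebra σ}

/-- A stable pair of a good algebra without a majority term up to ascent. -/
structure Bad (S : UAlgebra σ) (p : S.carrier × S.carrier) : Prop where
  good : Good S
  st : Stable S p
  nw : ¬ W2 S p

namespace Bad

variable {p k : S.carrier × S.carrier}

theorem of_LR (h : Bad S p) (hk : LR S p k) : Bad S k :=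
  ⟨h.good, h.st.of_LR h.good.idem hk, fun hw => h.nw (hw.of_LR h.good.idem hk)⟩

theorem t_fun (h : Bad S p) {x u v : S.carrier} (hu : T S p x u) (hv : T S p x v) : u = v :=
  by_contra fun hne => h.nw (h.good.w2_of_linked h.st hu hv hne)

/-- The automorphism exchanging the components of the pair. -/
noncomputable def fl (h : Bad S p) (x : S.carrier) : S.carrier := (h.st.t_total x).choose

theorem t_iff (h : Bad S p) {x y : S.carrier} : T S p x y ↔ h.fl x = y :=
  ⟨h.t_fun (h.st.t_total x).choose_spec, fun e => e ▸ (h.st.t_total x).choose_spec⟩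

theorem t_fl (h : Bad S p) (x : S.carrier) : T S p x (h.fl x) := h.t_iff.2 rfl

theorem fl_hom (h : Bad S p) : S.IsHom S h.fl := fun f x =>
  h.t_iff.1 (t_compat p f x _ fun j => h.t_fl (x j))

@[simp] theorem fl_fl (h : Bad S p) (x : S.carrier) : h.fl (h.fl x) = x :=
  h.t_iff.1 (t_symm (h.t_fl x))

theorem fl_inj (h : Bad S p) : Function.Injective h.fl := fun x y e => by
  rw [← h.fl_fl x, e, h.fl_fl]

theorem fl_legit (h : Bad S p) (hk : LR S p k) : h.fl k.1 = k.2 := h.t_iff.1 (hk.t (t_self k))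

@[simp] theorem fl_left (h : Bad S p) : h.fl p.1 = p.2 := h.fl_legit .refl

@[simp] theorem fl_right (h : Bad S p) : h.fl p.2 = p.1 := by rw [← h.fl_left, h.fl_fl]

theorem fl_of_LR (h : Bad S p) (hk : LR S p k) : (h.of_LR hk).fl = h.fl :=
  funext fun x => (h.t_iff.1 (hk.t ((h.of_LR hk).t_fl x))).symm

theorem size_fl (h : Bad S p) (x y : S.carrier) : size S (h.fl x) (h.fl y) = size S x y :=
  size_hom_inj h.fl_hom h.fl_inj x y

theorem up_fl (h : Bad S p) {x y : S.carrier} (hxy : Up S x y) : Up S (h.fl x) (h.fl y) :=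
  Relation.ReflTransGen.lift h.fl (fun _ _ => Th.hom h.fl_hom) _ _ hxy

theorem not_goodElt (h : Bad S p) (c : S.carrier) : ¬ GoodElt S p c := by
  intro hc
  refine h.nw (h.good.w2_of_goodElt h.st (h.t_fl c) hc fun k hk d hd => ?_)
  have hd' := h.up_fl hd
  rw [h.fl_fl] at hd'
  have := hc k hk _ hd'
  rw [← h.fl_legit hk]
  rw [← h.fl_legit hk] at this
  rw [← h.size_fl k.1 d, ← h.size_fl (h.fl k.1) d, h.fl_fl]
  exact ⟨this.2, this.1⟩

theorem tol (h : Bad S p) {U : S.carrier → S.carrier → Prop}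
    (hU : Compat S S U) (hrefl : ∀ x, U x x) (hsymm : ∀ x y, U x y → U y x) :
    (∀ x y, U x y → x = y) ∨ ∀ x y, U x y := by
  by_contra! hcon
  obtain ⟨⟨u, v, huv, hne⟩, hprop⟩ := hcon
  have := h.good.fin
  obtain ⟨c, hc⟩ := h.st.exists_goodElt h.good.idem h.good.simple hU hrefl hsymm hprop huv hne
  exact h.not_goodElt c hc

theorem r3_iff (h : Bad S p) (hk : LR S p k) {u v w : S.carrier} :
    R3 S k.1 k.2 u v w ↔ R3 S p.1 p.2 u v w :=
  ⟨hk.r3 h.good.idem, (h.st.max k hk).r3 h.good.idem⟩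

theorem r3_sq (h : Bad S p) {u v w : S.carrier} (hr : R3 S p.1 p.2 u v w) :
    R3 (sq S) p p.swap (u, h.fl u) (v, h.fl v) (w, h.fl w) := by
  obtain ⟨r, rfl, rfl, rfl⟩ := hr
  refine ⟨r, ?_, ?_, ?_⟩ <;> simp [h.fl_hom.b3]

theorem not_r3 (h : Bad S p) : ¬ R3 S p.1 p.2 p.1 p.1 p.1 := fun hr => by
  have := h.r3_sq hr
  rw [h.fl_left] at this
  exact h.nw ⟨p, .refl, this⟩

theorem gen2_of_r3 (h : Bad S p) {z : S.carrier} (hr : R3 S p.1 p.2 p.1 p.1 z)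
    (y : S.carrier) : Gen2 S p.1 z y := by
  have := h.good.fin
  by_contra hy
  have hs := size_lt_card hy
  have hr' := h.r3_sq hr
  rw [h.fl_left] at hr'
  refine h.nw (h.good.w2_of_r3 h.st .refl hr' hs ?_)
  change size S p.2 (h.fl z) < _
  rwa [← h.fl_left, h.size_fl]

theorem exists_gen (h : Bad S p) {c : S.carrier} (hc : size S p.1 c < Nat.card S.carrier) :
    ∃ k, LR S p k ∧ Gen2 S p.1 c k.1 ∧ ∃ d, Up S (h.fl c) d ∧ ∀ y, Gen2 S k.1 d y := by
  have := h.good.fin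
  by_contra! hcon
  refine h.nw (h.good.w2_of_t h.st (z := (c, h.fl c)) (h.t_fl c) hc ?_ ?_)
  · change size S p.2 (h.fl c) < _
    rwa [← h.fl_left, h.size_fl]
  · intro k hk hg c' d hc' hd
    obtain ⟨y, hy⟩ := hcon k hk hg d hd
    obtain ⟨y', hy'⟩ := hcon k hk hg _ (h.up_fl hc')
    refine ⟨size_lt_card hy, ?_⟩
    have := size_lt_card hy'
    rwa [← h.size_fl, h.fl_fl, h.fl_legit hk] at this

theorem r3_gen2 (h : Bad S p) (y : S.carrier) : R3 S p.1 p.2 p.1 y (h.fl y) := by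
  obtain ⟨s, rfl⟩ := h.st.gen y
  rw [h.fl_hom.b2, h.fl_left, h.fl_right]
  exact ⟨c2 s q0 q1, by simp [h.good.idem.b2]⟩

/-- The relation whose transitive closure is a preorder with least element `p.1` and greatest
element `p.2`. -/
def V (h : Bad S p) (x y : S.carrier) : Prop := ∃ w, R3 S p.1 p.2 x (h.fl y) w

theorem v_compat (h : Bad S p) : Compat S S h.V := by
  intro f x y hxy
  choose w r h1 h2 h3 using hxy
  refine ⟨S.interp f w, .app f r, ?_, ?_, ?_⟩
  · simp only [UAlgebra.b3, Term.eval]; exact congrArg _ (funext h1)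
  · rw [h.fl_hom]; simp only [UAlgebra.b3, Term.eval]; exact congrArg _ (funext h2)
  · simp only [UAlgebra.b3, Term.eval]; exact congrArg _ (funext h3)

theorem v_left (h : Bad S p) (y : S.carrier) : h.V p.1 y := ⟨_, h.r3_gen2 (h.fl y)⟩

theorem v_right (h : Bad S p) (x : S.carrier) : h.V x p.2 := by
  rw [V, h.fl_right]
  exact ⟨_, (h.r3_gen2 x).swap12⟩

theorem v_refl (h : Bad S p) (x : S.carrier) : h.V x x := ⟨_, (h.r3_gen2 x).rot⟩

theorem v_full_of (h : Bad S p) (hv : h.V p.2 p.1) (x y : S.carrier) : h.V x y := by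
  have hS := h.good.idem
  have h2 : ∀ y, h.V p.2 y := h.st.forall_of_nbr hS h.v_compat hv (h.v_right _)
  have hc : Compat S S fun x y => h.V y x := fun f x y hxy => h.v_compat f y x hxy
  exact h.st.forall_of_nbr hS hc (h.v_left y) (h2 y) x

theorem v_full_or_not_pw (h : Bad S p) :
    (∀ x y, h.V x y) ∨ ∀ k, ¬ pw h.V k p.2 p.1 := by
  classical
  by_contra! hcon
  obtain ⟨hnf, hex⟩ := hcon
  obtain ⟨k, hk, hmin⟩ : ∃ k, pw h.V k p.2 p.1 ∧ ∀ l < k, ¬ pw h.V l p.2 p.1 :=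
    ⟨Nat.find hex, Nat.find_spec hex, fun l hl => Nat.find_min hex hl⟩
  obtain ⟨x, y, hxy⟩ := hnf
  match k, hk, hmin with
  | 0, hk, _ => exact h.st.ne hk.symm
  | 1, hk, _ => exact hxy (h.v_full_of ((pw_one _).1 hk) x y)
  | k + 2, ⟨y, h1, h2⟩, hmin =>
    have hc := pw_compat h.v_compat (k + 1)
    rcases h.tol (U := fun x y => pw h.V (k + 1) x y ∧ pw h.V (k + 1) y x)
      (fun f x y hxy => ⟨hc f x y fun j => (hxy j).1, hc f y x fun j => (hxy j).2⟩)
      (fun x => ⟨pw_refl h.v_refl _ x, pw_refl h.v_refl _ x⟩) (fun _ _ hxy => hxy.symm) with h' | h'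
    · have := h' p.2 y ⟨h1, y, pw_refl h.v_refl _ y, h.v_right y⟩
      subst this
      exact hmin 1 (by omega) ((pw_one _).2 h2)
    · exact hmin (k + 1) (by omega) (h' p.2 p.1).1

/-- An order compatible with the operations, with least element `p.1` and greatest element
`p.2`, is impossible. -/
theorem not_order (h : Bad S p) {Q : S.carrier → S.carrier → Prop} (hQ : Compat S S Q)
    (hrefl : ∀ x, Q x x) (htr : ∀ x y z, Q x y → Q y z → Q x z)
    (hanti : ∀ x y, Q x y → Q y x → x = y) (hbot : ∀ x, Q p.1 x) (htop : ∀ x, Q x p.2)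
    (hV : ¬ h.V p.2 p.1) : False := by
  classical
  have hS := h.good.idem
  have hfin := h.good.fin
  have hint : ∀ u v, S.IsClosed {z | Q u z ∧ Q z v} := by
    intro u v f z hz
    refine ⟨?_, ?_⟩
    · have := hQ f (fun _ => u) z fun j => (hz j).1
      rwa [hS] at this
    · have := hQ f z (fun _ => v) fun j => (hz j).2
      rwa [hS] at this
  have hlegit : ∀ k, LR S p k → k = p := by
    intro k hk
    induction hk with
    | refl => rfl
    | @tail q k _ hst ih =>
      subst ih
      have hL : LR S q k := .single hst
      obtain ⟨-, t, ht1, ht2⟩ := hst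
      simp only [b2_pr, Prod.ext_iff] at ht1 ht2
      have hle : Q k.1 k.2 := by
        have h1 : Q k.1 (S.b2 t k.1 k.2) := by
          have := hQ.b2 t (hrefl k.1) (hbot k.2)
          rwa [ht2.1] at this
        have h2 : Q (S.b2 t k.1 k.2) k.2 := by
          have := hQ.b2 t (htop k.1) (hrefl k.2)
          rwa [ht1.2] at this
        exact htr _ _ _ h1 h2
      have hs := h.st.of_LR hS hL
      have := ((hs.gen q.1).closed (hint k.1 k.2) ⟨hrefl _, hle⟩ ⟨hle, hrefl _⟩).1
      have e1 := hanti _ _ this (hbot _)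
      refine Prod.ext e1 ?_
      rw [← h.fl_legit hL, e1, h.fl_left]
  have hgen : ∀ c, (∀ y, Gen2 S p.1 c y) → c = p.2 := fun c hc =>
    hanti _ _ (htop c) ((hc p.2).closed (hint p.1 c) ⟨hrefl _, hbot _⟩ ⟨hbot _, hrefl _⟩).2
  have hr3 : ∀ z, R3 S p.1 p.2 p.1 p.1 z → z = p.2 := fun z hz => hgen z (h.gen2_of_r3 hz)
  have htwo : ∀ c, c = p.1 ∨ c = p.2 := by
    intro c
    by_contra! hc
    have hsz : size S p.1 c < Nat.card S.carrier :=
      by_contra fun hn => hc.2 (hgen c (gen2_of_card_le hn))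
    obtain ⟨k, z, w, hl, e1, e2, e3, e4, -⟩ := (h.good.ih p (c, h.fl c) hsz (by
      change size S p.2 (h.fl c) < _
      rwa [← h.fl_left, h.size_fl])).exists_term
    obtain rfl := hlegit k (lr_of_sq h.st.max (h.t_fl c) hl).1
    simp only [b3_pr, Prod.ext_iff] at e1 e2 e3 e4
    have hr := h.r3_gen2 c
    have e5 : S.b3 w (h.fl c) (h.fl c) k.2 = h.fl z.1 := by
      rw [← h.fl_left, ← h.fl_hom.b3, e4.1]
    have h1 := R3.b3 w hr hr.swap12 (r3_gen k.1 k.2)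
    rw [e2.1, e3.1, e5] at h1
    have hz : z.1 = k.1 := h.fl_inj (by rw [hr3 _ h1, h.fl_left])
    have h2 := R3.b3 w hr hr hr.swap12
    rw [e1.1, e4.1, hz, hS.b3] at h2
    exact hc.1 (h.fl_inj (by rw [hr3 _ h2, h.fl_left]))
  refine h.good.notset fun n t => ?_
  let I (A : Finset (Fin n)) : Fin n → S.carrier := fun i => if i ∈ A then p.2 else p.1
  let F (A : Finset (Fin n)) : Prop := t.eval S (I A) = p.2
  have hnF : ∀ A, ¬ F A → t.eval S (I A) = p.1 := fun A hA => (htwo _).resolve_right hA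
  let sub3 (g : Fin n → Fin 3) : Term σ 3 := t.sub fun i => .var (g i)
  have hsub : ∀ g x y z, S.b3 (sub3 g) x y z = t.eval S fun i => ![x, y, z] (g i) := by
    intro g x y z
    simp only [sub3, UAlgebra.b3, Term.eval_sub, Term.eval]
  have hpart : ∀ A B C : Finset (Fin n), (∀ i, (i ∈ A ∧ i ∉ B ∧ i ∉ C) ∨
      (i ∉ A ∧ i ∈ B ∧ i ∉ C) ∨ (i ∉ A ∧ i ∉ B ∧ i ∈ C)) → ∃ q : Term σ 3,
      b3 S q p.2 p.1 p.1 = t.eval S (I A) ∧ b3 S q p.1 p.2 p.1 = t.eval S (I B) ∧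
      b3 S q p.1 p.1 p.2 = t.eval S (I C) := by
    intro A B C hABC
    refine ⟨sub3 fun i => if i ∈ A then 0 else if i ∈ B then 1 else 2, ?_, ?_, ?_⟩ <;>
      rw [hsub] <;> congr 1 <;> funext i <;> rcases hABC i with ⟨h1, h2, h3⟩ | ⟨h1, h2, h3⟩ |
        ⟨h1, h2, h3⟩ <;> simp [I, h1, h2, h3]
  have hdisj : ∀ A B, Disjoint A B → F A → ¬ F B := by
    intro A B hAB hA hB
    obtain ⟨q, -, hqB, hqA⟩ := hpart (A ∪ B)ᶜ B A fun i => by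
      have : i ∈ A → i ∉ B := fun h1 => Finset.disjoint_left.1 hAB h1
      simp only [Finset.mem_compl, Finset.mem_union]
      tauto
    refine hV ?_
    rw [V, h.fl_left]
    exact ⟨_, q, by rw [hqA, hA], by rw [hqB, hB], rfl⟩
  have hcompl : ∀ A, ¬ F A → F Aᶜ := by
    intro A hA
    have : I Aᶜ = fun i => h.fl (I A i) := by
      funext i
      by_cases hi : i ∈ A <;> simp [I, hi]
    change t.eval S (I Aᶜ) = p.2
    rw [this, ← h.fl_hom.eval, hnF A hA, h.fl_left]
  have huniv : F Finset.univ := hS.eval t _ _ fun i => by simp [I]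
  obtain ⟨A, hA, hmin⟩ := (Set.toFinite {A | F A}).exists_minimalFor Finset.card _
    ⟨Finset.univ, huniv⟩
  have hAne : A.Nonempty := by
    by_contra hne
    rw [Finset.not_nonempty_iff_eq_empty] at hne
    subst hne
    exact h.st.ne ((hS.eval t (I ∅) p.1 fun i => by simp [I]).symm.trans hA)
  obtain ⟨i, hi⟩ := hAne
  have hFi : F {i} := by
    by_contra hFi
    have h1 : ¬ F Aᶜ := hdisj A Aᶜ disjoint_compl_right hA
    have h2 : ¬ F (A.erase i) := fun hF => by
      have := hmin hF (Finset.card_le_card (Finset.erase_subset i A))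
      rw [Finset.card_erase_of_mem hi] at this
      have := Finset.card_pos.2 ⟨i, hi⟩
      omega
    obtain ⟨q, hq1, hq2, hq3⟩ := hpart {i} (A.erase i) Aᶜ fun j => by
      simp only [Finset.mem_compl, Finset.mem_erase, Finset.mem_singleton]
      by_cases hj : j = i
      · subst hj; simp [hi]
      · simp [hj]; tauto
    rw [hnF _ hFi] at hq1
    rw [hnF _ h2] at hq2
    rw [hnF _ h1] at hq3
    exact h.not_r3 ⟨q, hq3, hq2, hq1⟩
  refine ⟨i, fun x => ?_⟩
  let B : Finset (Fin n) := Finset.univ.filter fun j => x j = p.2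
  have hB : x = I B := by
    funext j
    by_cases hj : x j = p.2
    · simp [I, B, hj]
    · simp [I, B, (htwo (x j)).resolve_right hj]
  by_cases hiB : i ∈ B
  · have hFB : F B := by
      by_contra hn
      exact hdisj {i} Bᶜ (by simpa using hiB) hFi (hcompl B hn)
    rw [hB, hFB]
    simp [I, hiB]
  · have := hnF B (hdisj {i} B (by simpa using hiB) hFi)
    rw [hB, this]
    simp [I, hiB]

theorem v_full (h : Bad S p) (x y : S.carrier) : h.V x y := by
  rcases h.v_full_or_not_pw with h' | h'
  · exact h' x y
  · exfalso
    have hadd : ∀ {k l x y z}, pw h.V k x y → pw h.V l y z → pw h.V (k + l) x z :=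
      fun h1 h2 => (pw_add _ _ _).2 ⟨_, h1, h2⟩
    have mono : ∀ {k l x y}, k ≤ l → pw h.V k x y → pw h.V l x y := by
      intro k l x y hkl hk
      obtain ⟨m, rfl⟩ := Nat.exists_eq_add_of_le hkl
      exact hadd hk (pw_refl h.v_refl m y)
    let Q (x y : S.carrier) : Prop := ∃ k, pw h.V k x y
    have hQ : Compat S S Q := by
      intro f x y hxy
      choose k hk using hxy
      exact ⟨Finset.univ.sup k, pw_compat h.v_compat _ f x y fun j =>
        mono (Finset.le_sup (Finset.mem_univ j)) (hk j)⟩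
    have hrefl : ∀ x, Q x x := fun x => ⟨0, rfl⟩
    refine h.not_order hQ hrefl (fun _ _ _ ⟨_, h1⟩ ⟨_, h2⟩ => ⟨_, hadd h1 h2⟩) ?_
      (fun x => ⟨1, (pw_one _).2 (h.v_left x)⟩) (fun x => ⟨1, (pw_one _).2 (h.v_right x)⟩)
      (fun hv => h' 1 ((pw_one _).2 hv))
    rcases h.tol (U := fun x y => Q x y ∧ Q y x)
      (fun f x y hxy => ⟨hQ f x y fun j => (hxy j).1, hQ f y x fun j => (hxy j).2⟩)
      (fun x => ⟨hrefl x, hrefl x⟩) (fun _ _ hxy => hxy.symm) with h2 | h2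
    · exact fun x y h3 h4 => h2 x y ⟨h3, h4⟩
    · obtain ⟨-, k, hk⟩ := h2 p.1 p.2
      exact absurd hk (h' k)

theorem r3_total (h : Bad S p) (x y : S.carrier) : ∃ z, R3 S p.1 p.2 x y z := by
  obtain ⟨z, hz⟩ := h.v_full x (h.fl y)
  rw [h.fl_fl] at hz
  exact ⟨z, hz⟩

theorem r3_isClosed (S : UAlgebra σ) (a b : S.carrier) (f : σ.ops)
    (x y z : Fin (σ.arity f) → S.carrier) (hr : ∀ j, R3 S a b (x j) (y j) (z j)) :
    R3 S a b (S.interp f x) (S.interp f y) (S.interp f z) := by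
  choose r h1 h2 h3 using hr
  exact ⟨.app f r, congrArg (S.interp f) (funext h1), congrArg (S.interp f) (funext h2),
    congrArg (S.interp f) (funext h3)⟩

theorem r3_compat (h : Bad S p) (u : S.carrier) : Compat S S (R3 S p.1 p.2 u) := by
  intro f x y hxy
  have := r3_isClosed S p.1 p.2 f (fun _ => u) x y hxy
  rwa [h.good.idem] at this

theorem not_r3_right (h : Bad S p) : ¬ R3 S p.1 p.2 p.1 p.2 p.2 := by
  rintro ⟨t, h1, h2, h3⟩
  have h2' := congrArg h.fl h2
  have h3' := congrArg h.fl h3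
  simp only [h.fl_hom.b3, h.fl_left, h.fl_right] at h2' h3'
  let q : Term σ 3 := c3 t q0 q2 q1
  refine h.not_r3 ⟨c3 q q0 q q2, ?_, ?_, ?_⟩ <;>
    simp [q, h1, h2, h3, h2', h3', h.good.idem.b3]

theorem comp_tol (h : Bad S p) {U : S.carrier → S.carrier → Prop} (hU : Compat S S U)
    (hsymm : ∀ x y, U x y → U y x) (htot : ∀ x, ∃ y, U x y) :
    (∀ x y z, U x y → U x z → y = z) ∨ ∃ x, U p.1 x ∧ U x p.2 := by
  rcases h.tol (U := fun x y => ∃ z, U x z ∧ U z y)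
    (fun f x y hxy => by
      choose z h1 h2 using hxy
      exact ⟨_, hU f x z h1, hU f z y h2⟩)
    (fun x => by
      obtain ⟨y, hy⟩ := htot x
      exact ⟨y, hy, hsymm _ _ hy⟩)
    (fun x y ⟨z, h1, h2⟩ => ⟨z, hsymm _ _ h2, hsymm _ _ h1⟩) with h' | h'
  · exact .inl fun x y z h1 h2 => h' y z ⟨x, hsymm _ _ h1, h2⟩
  · exact .inr (h' p.1 p.2)

theorem r3_left_iff (h : Bad S p) {y z : S.carrier} : R3 S p.1 p.2 p.1 y z ↔ z = h.fl y := by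
  have hS := h.good.idem
  have hfin := h.good.fin
  have hsymm : ∀ x y, R3 S p.1 p.2 p.1 x y → R3 S p.1 p.2 p.1 y x := fun _ _ h => h.swap23
  rcases h.comp_tol (h.r3_compat p.1) hsymm (h.r3_total p.1) with h' | ⟨x, h1, h2⟩
  · exact ⟨fun hr => h' y _ _ hr (h.r3_gen2 y), fun e => e ▸ h.r3_gen2 y⟩
  · exfalso
    refine h.not_goodElt x (h.st.goodElt_of_center hS (h.r3_compat p.1) hsymm (h.r3_total p.1)
      (fun k hk => ?_) (h.st.forall_of_nbr hS (h.r3_compat p.1) (hsymm _ _ h1) h2))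
    have hr := h.r3_gen2 k.1
    rw [h.fl_legit hk] at hr
    have hkp := h.st.max k hk
    have up1 : Up S k.1 p.1 := Relation.ReflTransGen.lift Prod.fst
      (fun _ _ h => h.2.hom isHom_fst) _ _ hkp
    have up2 : Up S k.2 p.2 := Relation.ReflTransGen.lift Prod.snd
      (fun _ _ h => h.2.hom isHom_snd) _ _ hkp
    refine ⟨⟨k.2, hr, ?_⟩, ⟨k.1, hsymm _ _ hr, ?_⟩⟩
    · by_contra! hn
      exact h.not_r3_right (h.st.forall_of_up hS (h.r3_compat p.1) (h.r3_total p.1) hn up2 p.2)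
    · by_contra! hn
      exact h.not_r3 (h.st.forall_of_up hS (h.r3_compat p.1) (h.r3_total p.1) hn up1 p.1)

theorem r3_legit_iff (h : Bad S p) (hk : LR S p k) {y z : S.carrier} :
    R3 S p.1 p.2 k.1 y z ↔ z = h.fl y := by
  rw [← h.r3_iff hk, (h.of_LR hk).r3_left_iff, h.fl_of_LR hk]

theorem r3_right_fun (h : Bad S p) {x y z : S.carrier} (hy : R3 S p.1 p.2 p.2 x y)
    (hz : R3 S p.1 p.2 p.2 x z) : y = z := by
  rcases h.comp_tol (h.r3_compat p.2) (fun _ _ h => h.swap23) (h.r3_total p.2) with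
    h' | ⟨x, h1, h2⟩
  · exact h' x y z hy hz
  · exfalso
    have e := h.r3_left_iff.1 h1.swap12
    rw [h.fl_right] at e
    subst e
    exact h.st.ne ((h.r3_left_iff.1 h2.swap12).trans h.fl_right).symm

theorem lr_of_up (h : Bad S p) {x : S.carrier} (hx : Up S p.1 x) : LR S p (x, h.fl x) := by
  induction hx with
  | refl => rw [h.fl_left]; exact .refl
  | @tail x y _ hxy ih =>
    refine ih.tail ⟨(h.st.max _ ih).t (h.t_fl y), ?_⟩
    obtain ⟨t, h1, h2⟩ := hxy
    exact ⟨t, by simp [← h.fl_hom.b2, h1], by simp [← h.fl_hom.b2, h2]⟩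

/-- No element of `R3` has two constant components. -/
theorem not_r3_forall (h : Bad S p) {u v : S.carrier} (hall : ∀ y, R3 S p.1 p.2 y u v) :
    False := by
  have hS := h.good.idem
  have hfin := h.good.fin
  have hv : v = h.fl u := h.r3_left_iff.1 (hall p.1)
  have hu : h.fl v = u := by rw [hv, h.fl_fl]
  have hk : ∀ k, LR S p k → ∀ y, R3 S p.1 p.2 u k.1 y → y = v := fun k hk y hr => by
    rw [hv]; exact (h.r3_legit_iff hk).1 hr.swap12
  have hcen : ∀ c, (∀ z, R3 S p.1 p.2 u c z) → c = v := fun c hc =>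
    hk p .refl c (hc p.1).swap23
  have hcv : ∀ z, R3 S p.1 p.2 u v z := fun z => (hall z).rot
  have hupv : ∀ d, Up S v d → d = v := fun d hd => hcen d
    (h.st.forall_of_up hS (h.r3_compat u) (h.r3_total u) hcv hd)
  have hupu : ∀ d, Up S u d → d = u := fun d hd => h.fl_inj (by
    rw [← hv]; exact hupv _ (by rw [hv]; exact h.up_fl hd))
  have hkne : ∀ k, LR S p k → v ≠ k.1 ∧ v ≠ k.2 := by
    intro k hk
    have hne := (h.st.of_LR hS hk).ne
    have hf := h.fl_legit hk
    have hnr : ¬ R3 S p.1 p.2 k.1 k.2 k.2 := fun hr => by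
      have := (h.r3_legit_iff hk).1 hr
      rw [← hf, h.fl_fl] at this
      exact hne (this.symm.trans (by rw [hf] at *))
    constructor
    · intro e
      have hu' : u = k.2 := by rw [← hu, e, hf]
      have := hall k.2
      rw [hu', e] at this
      exact hnr this.rot.rot
    · intro e
      have hu' : u = k.1 := by rw [← hu, e, ← hf, h.fl_fl]
      have := hall k.2
      rw [hu', e] at this
      exact hnr this.swap12
  have htau : ∀ k, LR S p k → ∀ y, Gen2 S k.1 u y → ∃ y', Gen2 S k.1 v y' ∧
      R3 S p.1 p.2 k.2 y y' := by
    rintro k hk _ ⟨s, rfl⟩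
    have h1 : R3 S p.1 p.2 k.2 k.1 k.1 := ((h.r3_iff hk).1 (r3_gen k.1 k.2)).rot.rot
    exact ⟨_, ⟨s, rfl⟩, (h.r3_compat k.2).b2 s h1 (hall k.2)⟩
  by_cases hcase : ∃ k, LR S p k ∧ size S k.1 v < Nat.card S.carrier
  · obtain ⟨k, hk1, hsz⟩ := hcase
    have hb := h.of_LR hk1
    obtain ⟨l, hl, hg, d, hd, hall'⟩ := hb.exists_gen hsz
    rw [h.fl_of_LR hk1, hu] at hd
    rw [hupu d hd] at hall'
    have hl' := hk1.trans hl
    have hfull : ∀ y, Gen2 S k.1 v y := by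
      intro y
      obtain ⟨y', hy'⟩ := h.r3_total l.2 y
      obtain ⟨y'', h1, h2⟩ := htau l hl' y' (hall' y')
      have hb' := h.of_LR hl'
      have : y = y'' := hb'.r3_right_fun ((h.r3_iff hl').2 hy'.swap23) ((h.r3_iff hl').2 h2)
      rw [this]
      exact hg.trans (Gen2.right _ _) h1
    refine absurd hsz (not_lt.2 ?_)
    rw [← Set.ncard_univ]
    exact Set.ncard_le_ncard (fun y _ => hfull y) (Set.toFinite _)
  · push Not at hcase
    have hgen : ∀ k, LR S p k → ∀ y, Gen2 S k.1 v y := fun k hk =>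
      gen2_of_card_le (not_lt.2 (hcase k hk))
    have hform : ∀ q, LR S (p.1, v) q → q.2 = v ∧ LR S p (q.1, h.fl q.1) := by
      intro q hq
      have hup : Up S p.1 q.1 :=
        Relation.ReflTransGen.lift Prod.fst (fun _ _ h => h.2.hom isHom_fst) (p.1, v) q hq
      exact ⟨hupv _ (Relation.ReflTransGen.lift Prod.snd (fun _ _ h => h.2.hom isHom_snd) _ _ hq),
        h.lr_of_up hup⟩
    obtain ⟨⟨a, v'⟩, hq, hmax⟩ := exists_LRmax (p.1, v)
    obtain ⟨rfl, ha⟩ := hform _ hq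
    have hst : Stable S (a, v') := ⟨(hkne (a, h.fl a) ha).1.symm, hgen (a, h.fl a) ha, hmax⟩
    by_cases hw : W2 S (a, v')
    · obtain ⟨⟨a', w⟩, hc, hr⟩ := hw.exact hS hmax
      obtain ⟨rfl, ha'⟩ := hform _ (hq.trans hc)
      have hst' := hst.of_LR hS hc
      rcases h.good.maj2 _ hst'.ne hst'.gen hr (h.fl a') with e | e
      · exact (h.st.of_LR hS ha').ne e.symm
      · exact (hkne _ ha').2 e.symm
    · have hb : Bad S (a, v') := ⟨h.good, hst, hw⟩
      have hfull : ∀ x y, R3 S p.1 p.2 u (hb.fl x) (hb.fl y) := by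
        intro x y
        obtain ⟨z, r, h1, h2, -⟩ := (h.of_LR ha).r3_total x y
        have e1 : hb.fl a = v' := hb.fl_left
        rw [← h1, ← h2, hb.fl_hom.b3, hb.fl_hom.b3]
        simp only [e1]
        exact (h.r3_compat u).b3 r (hcv _) (hcv _) (hcv _).swap23
      have h3 := hcen p.1 fun z => by
        have := hfull (hb.fl p.1) (hb.fl z)
        rwa [hb.fl_fl, hb.fl_fl] at this
      exact (hkne p .refl).1 h3.symm

theorem exists_op (h : Bad S p) : ∃ m : S.carrier → S.carrier → S.carrier,
    ∀ x y z, R3 S p.1 p.2 x y z ↔ m x y = z := by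
  choose m hm using h.r3_total
  refine ⟨m, fun x y z => ⟨fun hr => ?_, fun e => e ▸ hm x y⟩⟩
  rcases h.tol (U := fun y y' => ∃ u v, R3 S p.1 p.2 y u v ∧ R3 S p.1 p.2 y' u v)
    (fun f y y' hyy => by
      choose u v h1 h2 using hyy
      exact ⟨_, _, r3_isClosed S _ _ f y u v h1, r3_isClosed S _ _ f y' u v h2⟩)
    (fun x => ⟨x, m x x, hm x x, hm x x⟩)
    (fun x y ⟨u, v, h1, h2⟩ => ⟨u, v, h2, h1⟩) with h' | h'
  · exact h' _ _ ⟨x, y, (hm x y).rot.rot, hr.rot.rot⟩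
  · obtain ⟨u, v, h1, h2⟩ := h' p.1 p.2
    have hc : S.IsClosed {y | R3 S p.1 p.2 y u v} := by
      intro f y hy
      have := r3_isClosed S p.1 p.2 f y (fun _ => u) (fun _ => v) hy
      rwa [h.good.idem, h.good.idem] at this
    exact (h.not_r3_forall fun y => (h.st.gen y).closed hc h1 h2).elim

end Bad

end UAlgebra

end Functional

section CentralMaltsev

variable {σ : Signature}

namespace UAlgebra

variable {S : UAlgebra σ}

/-- A Mal'tsev operation commuting with the basic operations of an idempotent algebra. -/
structure CentralMal (S : UAlgebra σ) (M : S.carrier → S.carrier → S.carrier → S.carrier) :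
    Prop where
  idem : S.Idempotent
  left : ∀ x z, M x x z = z
  right : ∀ x z, M x z z = x
  comm : ∀ (f : σ.ops) (x y z : Fin (σ.arity f) → S.carrier),
    M (S.interp f x) (S.interp f y) (S.interp f z) = S.interp f fun j => M (x j) (y j) (z j)

namespace CentralMal

variable {M : S.carrier → S.carrier → S.carrier → S.carrier}

theorem eval (h : CentralMal S M) {n : ℕ} (t : Term σ n) (x y z : Fin n → S.carrier) :
    M (t.eval S x) (t.eval S y) (t.eval S z) = t.eval S fun j => M (x j) (y j) (z j) := by
  induction t with
  | var i => rfl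
  | app f ts ih =>
    simp only [Term.eval]
    rw [h.comm]
    exact congrArg _ (funext ih)

/-- The term condition. -/
theorem congr_eval (h : CentralMal S M) {n : ℕ} (t : Term σ n) (A : Finset (Fin n))
    {u u' x : Fin n → S.carrier} (y : Fin n → S.carrier)
    (e : t.eval S (A.piecewise u x) = t.eval S (A.piecewise u' x)) :
    t.eval S (A.piecewise u y) = t.eval S (A.piecewise u' y) := by
  have h1 := h.eval t (A.piecewise u' x) (A.piecewise u x) (A.piecewise u y)
  rw [← e, h.left] at h1
  rw [h1]
  congr 1
  funext j
  by_cases hj : j ∈ A <;> simp [hj, h.left, h.right]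

theorem th_eq (h : CentralMal S M) {x y : S.carrier} (hxy : Th S x y) : x = y := by
  obtain ⟨s, h1, h2⟩ := hxy
  have := h.congr_eval s {0} (u := ![x, x]) (u' := ![y, y]) (x := ![y, y]) ![x, x] (by
    have e1 : (({0} : Finset (Fin 2)).piecewise ![x, x] ![y, y]) = ![x, y] := by
      funext j; fin_cases j <;> simp [Finset.piecewise]
    have e2 : (({0} : Finset (Fin 2)).piecewise ![y, y] ![y, y]) = ![y, y] := by
      funext j; fin_cases j <;> simp [Finset.piecewise]
    rw [e1, e2]
    exact h1.trans (h.idem.b2 s y).symm)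
  have e1 : (({0} : Finset (Fin 2)).piecewise ![x, x] ![x, x]) = ![x, x] := by
    funext j; fin_cases j <;> simp [Finset.piecewise]
  have e2 : (({0} : Finset (Fin 2)).piecewise ![y, y] ![x, x]) = ![y, x] := by
    funext j; fin_cases j <;> simp [Finset.piecewise]
  rw [e1, e2] at this
  exact (h.idem.b2 s x).symm.trans (this.trans h2)

theorem eq_of_w2 (h : CentralMal S M) {x y : S.carrier} (hw : W2 S (x, y)) : x = y := by
  obtain ⟨x', y', w, hl, h1, -, h3, -, h5, -⟩ := hw.exists_term
  have hup : ∀ q, LR S (x, y) q → q = (x, y) := by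
    intro q hq
    induction hq with
    | refl => rfl
    | tail _ hs ih =>
      rw [ih] at hs
      exact Prod.ext (h.th_eq (hs.2.hom isHom_fst)).symm (h.th_eq (hs.2.hom isHom_snd)).symm
  obtain ⟨rfl, rfl⟩ := Prod.mk.inj (hup _ hl)
  have := h.congr_eval w {2} (u := ![y', y', y']) (u' := ![x', x', x']) (x := ![x', x', x'])
    ![y', x', x'] (by
      have e1 : (({2} : Finset (Fin 3)).piecewise ![y', y', y'] ![x', x', x']) = ![x', x', y'] := by
        funext j; fin_cases j <;> simp [Finset.piecewise]
      have e2 : (({2} : Finset (Fin 3)).piecewise ![x', x', x'] ![x', x', x']) = ![x', x', x'] := by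
        funext j; fin_cases j <;> simp [Finset.piecewise]
      rw [e1, e2]
      exact h1.trans (h.idem.b3 w x').symm)
  have e1 : (({2} : Finset (Fin 3)).piecewise ![y', y', y'] ![y', x', x']) = ![y', x', y'] := by
    funext j; fin_cases j <;> simp [Finset.piecewise]
  have e2 : (({2} : Finset (Fin 3)).piecewise ![x', x', x'] ![y', x', x']) = ![y', x', x'] := by
    funext j; fin_cases j <;> simp [Finset.piecewise]
  rw [e1, e2] at this
  exact h3.symm.trans (this.symm.trans h5)

/-- If all two-generated subalgebras are full and a square over a pair of pairs cannot be
completed, the algebra is a set. -/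
theorem isSetAlgebra (h : CentralMal S M) (hgen : ∀ x y : S.carrier, x ≠ y → ∀ z, Gen2 S x y z)
    {x y c d : S.carrier} (hxy : x ≠ y) (hcd : c ≠ d)
    (hno : ¬ ∃ r : Term σ 3, b3 S r x y y = x ∧ b3 S r d d c = c) : S.IsSetAlgebra := by
  have hQ : ∀ z w (r : Term σ 3), b3 S r x y y = z → b3 S r d d c = w → z = y ∨ w = d := by
    intro z w r hz hw
    by_contra hn
    push Not at hn
    obtain ⟨s1, e1⟩ := hgen z y hn.1 x
    obtain ⟨s2, e2⟩ := hgen c d hcd w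
    obtain ⟨s3, e3⟩ := hgen w d hn.2 c
    refine hno ⟨c2 s3 (c2 s1 r (c2 s2 q2 q1)) q0, ?_, ?_⟩
    · simp only [b3_c2, b3_q0, b3_q1, b3_q2, hz, h.idem.b2, e1]
    · simp only [b3_c2, b3_q0, b3_q1, b3_q2, hw, h.idem.b2, e2, e3]
  have hQt : ∀ (n : ℕ) (t : Term σ n) (A : Finset (Fin n)) (u v : Fin n → S.carrier),
      t.eval S (A.piecewise u fun _ => y) = y ∨ t.eval S (A.piecewise (fun _ => d) v) = d := by
    intro n t A u v
    choose s hs using fun j => hgen x y hxy (u j)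
    choose s' hs' using fun j => hgen d c hcd.symm (v j)
    refine hQ _ _ (t.sub (A.piecewise (fun j => c2 (s j) q0 q1) fun j => c2 (s' j) q1 q2)) ?_ ?_ <;>
    · rw [b3, Term.eval_sub]
      congr 1
      funext j
      by_cases hj : j ∈ A
      · simp only [hj, Finset.piecewise_eq_of_mem]
        first
        | exact (b3_c2 S _ _ _ _ _ _).trans (hs j)
        | exact (b3_c2 S _ _ _ _ _ _).trans (h.idem.b2 _ _)
      · simp only [hj, not_false_eq_true, Finset.piecewise_eq_of_notMem]
        first
        | exact (b3_c2 S _ _ _ _ _ _).trans (hs' j)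
        | exact (b3_c2 S _ _ _ _ _ _).trans (h.idem.b2 _ _)
  have hdich : ∀ (n : ℕ) (t : Term σ n) (A : Finset (Fin n)),
      (∀ u u' z : Fin n → S.carrier,
        t.eval S (A.piecewise u z) = t.eval S (A.piecewise u' z)) ∨
      (∀ u u' z : Fin n → S.carrier,
        t.eval S (A.piecewise z u) = t.eval S (A.piecewise z u')) := by
    intro n t A
    by_cases h1 : ∀ u : Fin n → S.carrier, t.eval S (A.piecewise u fun _ => y) = y
    · exact Or.inl fun u u' z => h.congr_eval t A z ((h1 u).trans (h1 u').symm)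
    · push Not at h1
      obtain ⟨u, hu⟩ := h1
      have h2 := fun v => (hQt n t A u v).resolve_left hu
      refine Or.inr fun v v' z => ?_
      rw [← A.piecewise_compl v z, ← A.piecewise_compl v' z]
      refine h.congr_eval t Aᶜ z (x := fun _ => d) ?_
      rw [Finset.piecewise_compl, Finset.piecewise_compl, h2, h2]
  intro n t
  by_cases h1 : ∃ i, ∀ u u' z : Fin n → S.carrier,
      t.eval S (({i} : Finset (Fin n)).piecewise z u) =
        t.eval S (({i} : Finset (Fin n)).piecewise z u')
  · obtain ⟨i, hi⟩ := h1
    refine ⟨i, fun z => ?_⟩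
    have e1 : ({i} : Finset (Fin n)).piecewise z z = z := by
      funext j
      by_cases hj : j = i <;> simp [hj]
    have e2 : ({i} : Finset (Fin n)).piecewise z (fun _ => z i) = fun _ => z i := by
      funext j
      by_cases hj : j = i
      · subst hj; simp
      · simp [hj]
    exact (congrArg _ e1.symm).trans ((hi z (fun _ => z i) z).trans
      ((congrArg _ e2).trans (h.idem.eval t _ _ fun _ => rfl)))
  · have h2 := fun i => (hdich n t {i}).resolve_right fun hc => h1 ⟨i, hc⟩
    have h3 : ∀ (A : Finset (Fin n)) (u z : Fin n → S.carrier),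
        t.eval S (A.piecewise u z) = t.eval S z := by
      intro A u z
      induction A using Finset.induction_on with
      | empty => simp
      | insert i A _ ih =>
        rw [Finset.piecewise_insert, ← ih]
        have := h2 i (fun _ => u i) (A.piecewise u z) (A.piecewise u z)
        simpa [Finset.piecewise_singleton] using this
    have := h3 Finset.univ (fun _ => x) (fun _ => y)
    rw [Finset.piecewise_univ] at this
    exact absurd ((h.idem.eval t _ _ fun _ => rfl).symm.trans
      (this.trans (h.idem.eval t _ _ fun _ => rfl))) hxy

theorem exists_maltsev [Finite S.carrier] (hS : S.Idempotent)
    (hloc : ∀ x y c d, ∃ r : Term σ 3, b3 S r x y y = x ∧ b3 S r d d c = c) :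
    ∃ r : Term σ 3, ∀ x y, b3 S r x y y = x ∧ b3 S r y y x = x := by
  classical
  have h1 : ∀ (x y : S.carrier) (F : Finset (S.carrier × S.carrier)), ∃ r : Term σ 3,
      b3 S r x y y = x ∧ ∀ q ∈ F, b3 S r q.1 q.1 q.2 = q.2 := by
    intro x y F
    induction F using Finset.induction_on with
    | empty => exact ⟨q0, by simp⟩
    | insert q F _ ih =>
      obtain ⟨t, ht1, ht2⟩ := ih
      obtain ⟨s, hs1, hs2⟩ := hloc x y q.2 (b3 S t q.1 q.1 q.2)
      refine ⟨c3 s t (c3 t q1 q1 q2) q2, ?_, fun q' hq' => ?_⟩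
      · simp [ht1, hS.b3, hs1]
      · rcases Finset.mem_insert.1 hq' with rfl | hq'
        · simp [hs2]
        · simp [ht2 _ hq', hS.b3]
  have h2 : ∀ x y : S.carrier, ∃ r : Term σ 3,
      b3 S r x y y = x ∧ ∀ c d, b3 S r d d c = c := by
    intro x y
    have := Fintype.ofFinite S.carrier
    obtain ⟨r, hr1, hr2⟩ := h1 x y Finset.univ
    exact ⟨r, hr1, fun c d => hr2 (d, c) (Finset.mem_univ _)⟩
  have h3 : ∀ (F : Finset (S.carrier × S.carrier)), ∃ r : Term σ 3,
      (∀ q ∈ F, b3 S r q.1 q.2 q.2 = q.1) ∧ ∀ c d, b3 S r d d c = c := by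
    intro F
    induction F using Finset.induction_on with
    | empty => exact ⟨q2, by simp⟩
    | insert q F _ ih =>
      obtain ⟨t, ht1, ht2⟩ := ih
      obtain ⟨s, hs1, hs2⟩ := h2 q.1 (b3 S t q.1 q.2 q.2)
      refine ⟨c3 s q0 (c3 t q0 q1 q1) t, fun q' hq' => ?_, fun c d => ?_⟩
      · rcases Finset.mem_insert.1 hq' with rfl | hq'
        · simp [hs1]
        · simp [ht1 _ hq', hS.b3]
      · simp [ht2, hs2]
  have := Fintype.ofFinite S.carrier
  obtain ⟨r, hr1, hr2⟩ := h3 Finset.univ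
  exact ⟨r, fun x y => ⟨hr1 (x, y) (Finset.mem_univ _), hr2 x y⟩⟩

theorem exists_b3 [Finite S.carrier] (h : CentralMal S M)
    (hgen : ∀ x y : S.carrier, x ≠ y → ∀ z, Gen2 S x y z) (hset : ¬ S.IsSetAlgebra) :
    ∃ r : Term σ 3, ∀ x y z, b3 S r x y z = M x y z := by
  obtain ⟨r, hr⟩ := exists_maltsev h.idem fun x y c d => by
    by_cases hxy : x = y
    · exact ⟨q2, by simp [hxy]⟩
    by_cases hcd : c = d
    · exact ⟨q0, by simp [hcd]⟩
    by_contra hno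
    exact hset (h.isSetAlgebra hgen hxy hcd hno)
  refine ⟨r, fun x y z => ?_⟩
  have := h.eval r ![x, y, y] ![y, y, y] ![y, y, z]
  have e : (fun j => M (![x, y, y] j) (![y, y, y] j) (![y, y, z] j)) = ![x, y, z] := by
    funext j; fin_cases j <;> simp [h.left, h.right]
  rw [e] at this
  refine this.symm.trans ?_
  change M (b3 S r x y y) (b3 S r y y y) (b3 S r y y z) = _
  rw [(hr _ _).1, h.idem.b3, (hr _ _).2]

end CentralMal

end UAlgebra

end CentralMaltsev

section Affine

variable {σ : Signature}

namespace UAlgebra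

variable {S : UAlgebra σ}

/-- The additive endomorphisms that are linear parts of binary term operations. -/
def linearParts [AddCommGroup S.carrier] (r : Term σ 3) (hr : ∀ x y z, b3 S r x y z = x - y + z) :
    Subring (AddMonoid.End S.carrier) where
  carrier := {e | ∃ t : Term σ 2, ∀ x, b2 S t 0 x = e x}
  mul_mem' := by
    rintro e e' ⟨t, ht⟩ ⟨t', ht'⟩
    exact ⟨c2 t p0 t', fun x => by simp [ht, ht']⟩
  one_mem' := ⟨p1, fun x => by simp⟩
  add_mem' := by
    rintro e e' ⟨t, ht⟩ ⟨t', ht'⟩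
    exact ⟨c3 r t p0 t', fun x => by simp [ht, ht', hr]; rfl⟩
  zero_mem' := ⟨p0, fun x => by simp⟩
  neg_mem' := by
    rintro e ⟨t, ht⟩
    exact ⟨c3 r p0 t p0, fun x => by simp [ht, hr]; rfl⟩

theorem isAffineAlgebra_of_additive [Finite S.carrier] [Nontrivial S.carrier]
    [AddCommGroup S.carrier] (hS : S.Idempotent)
    (hadd : ∀ (n : ℕ) (t : Term σ n) (x y : Fin n → S.carrier),
      t.eval S (x + y) = t.eval S x + t.eval S y)
    (r : Term σ 3) (hr : ∀ x y z, b3 S r x y z = x - y + z) : S.IsAffineAlgebra := by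
  classical
  have hfin : Finite (AddMonoid.End S.carrier) :=
    DFunLike.finite (F := S.carrier →+ S.carrier)
  refine ⟨linearParts r hr, inferInstance, inferInstance, inferInstance, inferInstance,
    fun n g => ⟨?_, ?_⟩, r, hr⟩
  · rintro ⟨t, ht⟩
    let F : (Fin n → S.carrier) →+ S.carrier := AddMonoidHom.mk' (t.eval S) (hadd n t)
    have hF : ∀ x, F x = ∑ i, F (Pi.single i (x i)) := fun x => by
      rw [← map_sum, Finset.univ_sum_single]
    let c : Fin n → linearParts r hr := fun i =>
      ⟨F.comp (AddMonoidHom.single (fun _ => S.carrier) i),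
        t.sub fun j => if j = i then p1 else p0, fun x => by
          rw [b2, Term.eval_sub]
          change _ = t.eval S (Pi.single i x)
          congr 1
          funext j
          by_cases hj : j = i
          · subst hj; simp [p1, Term.eval]
          · simp [hj, p0, Term.eval]⟩
    have hc : ∀ i x, c i • x = F (Pi.single i x) := fun _ _ => rfl
    refine ⟨c, ?_, fun x => ?_⟩
    · refine Subtype.ext (AddMonoidHom.ext fun x => ?_)
      change (∑ i, c i) • x = x
      rw [Finset.sum_smul]
      simp only [hc]
      exact (hF fun _ => x).symm.trans (hS.eval t _ _ fun _ => rfl)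
    · simp only [hc, ← ht]
      exact hF x
  · rintro ⟨c, hc1, hc⟩
    cases n with
    | zero =>
      have h0 : ∀ x : S.carrier, x = 0 := fun x => by
        have : (1 : linearParts r hr) • x = (0 : linearParts r hr) • x := by
          rw [← hc1]; simp
        simpa using this
      obtain ⟨a, b, hab⟩ := exists_pair_ne S.carrier
      exact absurd ((h0 a).trans (h0 b).symm) hab
    | succ n =>
      have hbin : ∀ i, ∃ t : Term σ 2, ∀ a b, b2 S t a b = a + c i • (b - a) := by
        intro i
        obtain ⟨t, ht⟩ := (c i).2
        refine ⟨t, fun a b => ?_⟩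
        have h1 := hadd 2 t ![a, a] ![0, b - a]
        have e : (![a, a] + ![0, b - a] : Fin 2 → S.carrier) = ![a, b] := by
          funext j; fin_cases j <;> simp
        rw [e] at h1
        refine h1.trans ?_
        change b2 S t a a + b2 S t 0 (b - a) = _
        rw [hS.b2, ht]
        rfl
      have hs : ∀ s : Finset (Fin (n + 1)), ∃ t : Term σ (n + 1), ∀ x : Fin (n + 1) → S.carrier,
          t.eval S x = x 0 + ∑ i ∈ s, c i • (x i - x 0) := by
        intro s
        induction s using Finset.induction_on with
        | empty => exact ⟨.var 0, fun x => by simp [Term.eval]⟩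
        | insert i s hi ih =>
          obtain ⟨t, ht⟩ := ih
          obtain ⟨u, hu⟩ := hbin i
          refine ⟨c3 r t (.var 0) (c2 u (.var 0) (.var i)), fun x => ?_⟩
          rw [eval_c3, hr, eval_c2, hu, ht, Finset.sum_insert hi]
          simp only [Term.eval]
          abel
      obtain ⟨t, ht⟩ := hs Finset.univ
      refine ⟨t, fun x => ?_⟩
      rw [ht, hc]
      simp only [smul_sub, Finset.sum_sub_distrib, ← Finset.sum_smul, hc1, one_smul]
      abel

namespace CentralMal

variable {M : S.carrier → S.carrier → S.carrier → S.carrier}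

theorem medial (h : CentralMal S M) {r : Term σ 3} (hr : ∀ x y z, b3 S r x y z = M x y z)
    (a b c a' b' c' a'' b'' c'' : S.carrier) :
    M (M a b c) (M a' b' c') (M a'' b'' c'') = M (M a a' a'') (M b b' b'') (M c c' c'') := by
  have := h.eval r ![a, b, c] ![a', b', c'] ![a'', b'', c'']
  have e : (fun j => M (![a, b, c] j) (![a', b', c'] j) (![a'', b'', c''] j)) =
      ![M a a' a'', M b b' b'', M c c' c''] := by
    funext j; fin_cases j <;> simp
  rw [e] at this
  change M (b3 S r a b c) (b3 S r a' b' c') (b3 S r a'' b'' c'') = b3 S r _ _ _ at this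
  simpa only [hr] using this

/-- The abelian group with neutral element `o` underlying a central Mal'tsev operation. -/
abbrev addCommGroup (h : CentralMal S M) {r : Term σ 3} (hr : ∀ x y z, b3 S r x y z = M x y z)
    (o : S.carrier) : AddCommGroup S.carrier :=
  letI : Add S.carrier := ⟨fun x y => M x o y⟩
  letI : Zero S.carrier := ⟨o⟩
  letI : Neg S.carrier := ⟨fun x => M o x o⟩
  { nsmul := nsmulRec
    zsmul := zsmulRec
    add_assoc := fun x y z => by
      have := h.medial hr x o y o o o o o z
      simp only [h.left, h.right] at this
      exact this
    zero_add := fun x => h.left o x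
    add_zero := fun x => h.right x o
    neg_add_cancel := fun x => by
      have := h.medial hr o x o o o o o o x
      simp only [h.left, h.right] at this
      exact this
    add_comm := fun x y => by
      have := h.medial hr o o x o o o y o o
      simp only [h.left, h.right] at this
      exact this }

theorem isAffineAlgebra [Finite S.carrier] [Nontrivial S.carrier] (h : CentralMal S M)
    {r : Term σ 3} (hr : ∀ x y z, b3 S r x y z = M x y z) : S.IsAffineAlgebra := by
  obtain ⟨o, -, -⟩ := exists_pair_ne S.carrier
  let _ := h.addCommGroup hr o
  refine isAffineAlgebra_of_additive h.idem (fun n t x y => ?_) r fun x y z => ?_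
  · have := h.eval t x (fun _ => o) y
    rw [h.idem.eval t (fun _ => o) o fun _ => rfl] at this
    exact this.symm
  · have h1 := h.medial hr x o o o o o o y o
    simp only [h.left, h.right] at h1
    have h2 := h.medial hr x y o o o o o o z
    simp only [h.left, h.right] at h2
    rw [hr, ← h2, sub_eq_add_neg]
    change M (M x y o) o z = M (M x o (M o y o)) o z
    rw [h1]

end CentralMal

theorem Good.w2 (hG : Good S) {p : S.carrier × S.carrier} (hp : Stable S p) : W2 S p := by
  by_contra hw
  have h : Bad S p := ⟨hG, hp, hw⟩
  obtain ⟨m, hm⟩ := h.exists_op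
  have hcomm : ∀ x y, m x y = m y x := fun x y =>
    ((hm y x _).1 ((hm x y _).2 rfl).swap12).symm
  have hinv : ∀ x y, m x (m x y) = y := fun x y => (hm _ _ _).1 ((hm x y _).2 rfl).swap23
  have hop : ∀ (f : σ.ops) (x y : Fin (σ.arity f) → S.carrier),
      m (S.interp f x) (S.interp f y) = S.interp f fun j => m (x j) (y j) := fun f x y =>
    (hm _ _ _).1 (Bad.r3_isClosed S p.1 p.2 f x y _ fun j => (hm _ _ _).2 rfl)
  have hM : CentralMal S fun x y z => m (m x (m y y)) (m y z) :=
    ⟨hG.idem, fun x z => by rw [hcomm x (m x x), hcomm (m x x) x, hinv, hinv],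
      fun x z => by rw [hcomm x (m z z), hcomm, hinv], fun f x y z => by simp only [hop]⟩
  have hfin := hG.fin
  have hnt : Nontrivial S.carrier := ⟨p.1, p.2, hp.ne⟩
  have hgen : ∀ x y : S.carrier, x ≠ y → ∀ z, Gen2 S x y z := by
    intro x y hxy z
    by_contra hz
    have hsz := size_lt_card hz
    exact hxy (hM.eq_of_w2 ((hG.ih (x, x) (y, y) hsz hsz).hom isHom_fst))
  obtain ⟨r, hr⟩ := hM.exists_b3 hgen hG.notset
  exact hG.notaff (hM.isAffineAlgebra hr)

end UAlgebra

end Affine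

section TwoElement

variable {σ : Signature}

namespace UAlgebra

variable {S : UAlgebra σ}

/-- A term acting as a majority operation on the components of a pair. -/
def IsMaj (S : UAlgebra σ) (t : Term σ 3) (p : S.carrier × S.carrier) : Prop :=
  b3 (sq S) t p p p.swap = p ∧ b3 (sq S) t p p.swap p = p ∧ b3 (sq S) t p.swap p p = p

/-- An idempotent algebra with two elements, a majority term and no semilattice term. -/
structure Two (S : UAlgebra σ) (p : S.carrier × S.carrier) : Prop where
  idem : S.Idempotent
  ne : p.1 ≠ p.2
  two : ∀ z, z = p.1 ∨ z = p.2
  closed : ∀ z, Gen2 (sq S) p p.swap z → z = p ∨ z = p.swap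
  maj : ∃ t, IsMaj S t p

theorem IsMaj.swap {t : Term σ 3} {p : S.carrier × S.carrier} (h : IsMaj S t p) :
    IsMaj S t p.swap := by
  obtain ⟨h1, h2, h3⟩ := h
  have key := fun u v w : S.carrier × S.carrier => (isHom_swap (A := S) (B := S)).b3 t u v w
  refine ⟨?_, ?_, ?_⟩
  · exact (key _ _ _).symm.trans (congrArg Prod.swap h1)
  · exact (key _ _ _).symm.trans (congrArg Prod.swap h2)
  · exact (key _ _ _).symm.trans (congrArg Prod.swap h3)

theorem Two.ne_swap {p : S.carrier × S.carrier} (h : Two S p) : p ≠ p.swap :=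
  fun e => h.ne (congrArg Prod.fst e)

theorem Two.eq_of_LR {p q : S.carrier × S.carrier} (h : Two S p) (hq : LR S p q) : q = p := by
  induction hq with
  | refl => rfl
  | tail _ hs ih =>
    rw [ih] at hs
    obtain ⟨hg, t, h1, h2⟩ := hs
    rcases h.closed _ hg with e | e
    · exact e
    · rw [e] at h1 h2
      have := congrArg Prod.swap h1
      rw [(isHom_swap (A := S) (B := S)).b2 t] at this
      exact absurd (this.symm.trans h2) h.ne_swap

theorem exists_isMaj {ι : Type} [Finite ι] (S : ι → UAlgebra σ)
    (p : ∀ i, (S i).carrier × (S i).carrier) (h : ∀ i, Two (S i) (p i)) :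
    ∃ t, ∀ i, IsMaj (S i) t (p i) := by
  classical
  have := Fintype.ofFinite ι
  suffices ∀ K : Finset ι, ∃ t, ∀ i ∈ K, IsMaj (S i) t (p i) by
    obtain ⟨t, ht⟩ := this Finset.univ
    exact ⟨t, fun i => ht i (Finset.mem_univ i)⟩
  intro K
  induction K using Finset.induction_on with
  | empty => exact ⟨q0, by simp⟩
  | insert i K _ ih =>
    obtain ⟨M, hM⟩ := ih
    obtain ⟨m, hm⟩ := (h i).maj
    have hid := fun j => (h j).idem.pr (h j).idem
    let P := c3 m M (c3 M q1 q2 q0) (c3 M q2 q0 q1)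
    have hPK : ∀ j ∈ K, IsMaj (S j) P (p j) := by
      intro j hj
      obtain ⟨h1, h2, h3⟩ := hM j hj
      refine ⟨?_, ?_, ?_⟩ <;>
        simp only [P, b3_c3, b3_q0, b3_q1, b3_q2, h1, h2, h3, (hid j).b3]
    have hPi : IsMaj (S i) P (p i) ∨ (b3 (sq (S i)) P (p i) (p i) (p i).swap = (p i).swap) := by
      obtain ⟨h1, h2, h3⟩ := hm
      obtain ⟨h1', h2', h3'⟩ := IsMaj.swap ⟨h1, h2, h3⟩
      rw [Prod.swap_swap] at h1' h2' h3'
      rcases (h i).closed _ ⟨c3 M p0 p0 p1, b2_c3 ..⟩ with e1 | e1 <;>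
      rcases (h i).closed _ ⟨c3 M p0 p1 p0, b2_c3 ..⟩ with e2 | e2 <;>
      rcases (h i).closed _ ⟨c3 M p1 p0 p0, b2_c3 ..⟩ with e3 | e3 <;>
      simp only [b2_p0, b2_p1] at e1 e2 e3 <;>
      simp only [IsMaj, P, b3_c3, b3_q0, b3_q1, b3_q2, e1, e2, e3, h1, h2, h3, h1', h2', h3',
        (hid i).b3, and_self, true_or, or_true]
    rcases hPi with hPi | hPi
    · exact ⟨P, fun j hj => (Finset.mem_insert.1 hj).elim (fun e => e ▸ hPi) (hPK j)⟩
    · have hsw := congrArg Prod.swap hPi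
      rw [(isHom_swap (A := S i) (B := S i)).b3, Prod.swap_swap] at hsw
      have hP1 : ∀ u v, (u = p i ∨ u = (p i).swap) → (v = p i ∨ v = (p i).swap) →
          b3 (sq (S i)) P u u v = v := by
        rintro u v (rfl | rfl) (rfl | rfl)
        · exact (hid i).b3 _ _
        · exact hPi
        · exact hsw
        · exact (hid i).b3 _ _
      have hcl : ∀ t : Term σ 2, b2 (sq (S i)) t (p i) (p i).swap = p i ∨
          b2 (sq (S i)) t (p i) (p i).swap = (p i).swap := fun t => (h i).closed _ ⟨t, rfl⟩
      refine ⟨c3 P P P m, fun j hj => ?_⟩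
      rcases Finset.mem_insert.1 hj with rfl | hj
      · obtain ⟨h1, h2, h3⟩ := hm
        refine ⟨?_, ?_, ?_⟩
        · rw [b3_c3, h1]
          exact hP1 _ _ (by simpa using hcl (c3 P p0 p0 p1)) (Or.inl rfl)
        · rw [b3_c3, h2]
          exact hP1 _ _ (by simpa using hcl (c3 P p0 p1 p0)) (Or.inl rfl)
        · rw [b3_c3, h3]
          exact hP1 _ _ (by simpa using hcl (c3 P p1 p0 p0)) (Or.inl rfl)
      · have hPP := hPK j hj
        obtain ⟨h1, h2, h3⟩ := hPP
        have hlast : ∀ t : Term σ 2,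
            b3 (sq (S j)) P (p j) (p j) (b2 (sq (S j)) t (p j) (p j).swap) = p j := by
          intro t
          rcases (h j).closed _ ⟨t, rfl⟩ with e | e <;> rw [e]
          · exact (hid j).b3 _ _
          · exact h1
        refine ⟨?_, ?_, ?_⟩
        · rw [b3_c3, h1]; simpa using hlast (c3 m p0 p0 p1)
        · rw [b3_c3, h2]; simpa using hlast (c3 m p0 p1 p0)
        · rw [b3_c3, h3]; simpa using hlast (c3 m p1 p0 p0)

theorem IsHom.comp {A B C : UAlgebra σ} {φ : A.carrier → B.carrier} {ψ : B.carrier → C.carrier}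
    (hψ : B.IsHom C ψ) (hφ : A.IsHom B φ) : A.IsHom C (ψ ∘ φ) := fun f x => by
  rw [Function.comp_apply, hφ, hψ]; rfl

theorem isHom_subtype {A : UAlgebra σ} {D : Set A.carrier} (hD : A.IsClosed D) :
    (A.subalg D hD).IsHom A Subtype.val := fun _ _ => rfl

/-- Existence of a maximal congruence above a proper one. -/
theorem Congruence.exists_isMaximal [Finite S.carrier] (θ : Congruence S) (hθ : ¬ θ.IsFull) :
    ∃ κ : Congruence S, θ.le κ ∧ κ.IsMaximal := by
  let F : Set (Set (S.carrier × S.carrier)) :=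
    {R | ∃ κ : Congruence S, θ.le κ ∧ ¬ κ.IsFull ∧ R = {q | κ.rel q.1 q.2}}
  obtain ⟨R, ⟨κ, h1, h2, rfl⟩, hmax⟩ :=
    (Set.toFinite F).exists_maximal ⟨_, θ, fun _ _ h => h, hθ, rfl⟩
  refine ⟨κ, h1, h2, fun η hη hn x y hxy => ?_⟩
  exact hmax (y := {q | η.rel q.1 q.2}) ⟨η, fun _ _ h => hη _ _ (h1 _ _ h), hn, rfl⟩
    (fun q hq => hη _ _ hq) (show (x, y) ∈ {q : S.carrier × S.carrier | η.rel q.1 q.2} from hxy)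

theorem size_le_of_ker {G B : UAlgebra σ} [Finite B.carrier] {φ : G.carrier → B.carrier}
    {ψ : G.carrier → S.carrier} (hφ : G.IsHom B φ) (hψ : G.IsHom S ψ)
    (hk : ∀ u v, φ u = φ v → ψ u = ψ v) (x y : G.carrier) :
    size S (ψ x) (ψ y) ≤ size B (φ x) (φ y) := by
  classical
  let g : S.carrier → B.carrier := fun z =>
    if hz : Gen2 S (ψ x) (ψ y) z then b2 B hz.choose (φ x) (φ y) else φ x
  refine Set.ncard_le_ncard_of_injOn g (fun z hz => ?_) (fun z hz z' hz' e => ?_) (Set.toFinite _)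
  · exact ⟨Exists.choose hz, by simp only [g, dif_pos (show Gen2 S _ _ z from hz)]⟩
  · have hz : Gen2 S _ _ z := hz
    have hz' : Gen2 S _ _ z' := hz'
    simp only [g, dif_pos hz, dif_pos hz', ← hφ.b2] at e
    have := hk _ _ e
    rw [hψ.b2, hψ.b2, hz.choose_spec, hz'.choose_spec] at this
    exact this

end UAlgebra

end TwoElement

section Subdirect

variable {σ : Signature}

namespace UAlgebra

variable {A G : UAlgebra σ}

/-- The elements of the square generated by a pair and its transpose that have the same image as
the pair in every given factor. -/
def Fib {J : Type} (S : J → UAlgebra σ) (ψ : ∀ j, G.carrier → (S j).carrier)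
    (p z : G.carrier × G.carrier) : Prop :=
  Gen2 (sq G) p p.swap z ∧ ∀ j, Prod.map (ψ j) (ψ j) z = Prod.map (ψ j) (ψ j) p

section Fiber

variable {J : Type} {S : J → UAlgebra σ} {ψ : ∀ j, G.carrier → (S j).carrier}
  {p : G.carrier × G.carrier}

theorem Fib.of_LR (hψ : ∀ j, G.IsHom (S j) (ψ j))
    (hS : ∀ j, Two (S j) (Prod.map (ψ j) (ψ j) p)) {k : G.carrier × G.carrier}
    (h : LR G p k) : Fib S ψ p k :=
  ⟨h.t (t_self k), fun j => (hS j).eq_of_LR (h.hom (hψ j))⟩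

theorem gen2_swap {x : G.carrier × G.carrier} (h : Gen2 (sq G) p p.swap x) :
    Gen2 (sq G) p p.swap x.swap :=
  (Gen2.hom (isHom_swap (A := G) (B := G)) h).symm

theorem gen2_b3 {x y u v w : G.carrier} (t : Term σ 3) (hu : Gen2 G x y u)
    (hv : Gen2 G x y v) (hw : Gen2 G x y w) : Gen2 G x y (b3 G t u v w) :=
  (gen2_isClosed (A := G) x y).b3 t hu hv hw

variable {w : Term σ 3} {a b c : G.carrier × G.carrier}

theorem Fib.swap_left (hψ : ∀ j, G.IsHom (S j) (ψ j))
    (hw : ∀ j, IsMaj (S j) w (Prod.map (ψ j) (ψ j) p))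
    (ha : Fib S ψ p a) (hb : Fib S ψ p b) (hc : Fib S ψ p c) :
    Fib S ψ p (b3 (sq G) w a.swap b c) := by
  refine ⟨gen2_b3 w (gen2_swap ha.1) hb.1 hc.1, fun j => ?_⟩
  have e : Prod.map (ψ j) (ψ j) a.swap = (Prod.map (ψ j) (ψ j) a).swap := rfl
  rw [(isHom_map (hψ j)).b3, e, ha.2, hb.2, hc.2, (hw j).2.2]

theorem Fib.swap_mid (hψ : ∀ j, G.IsHom (S j) (ψ j))
    (hw : ∀ j, IsMaj (S j) w (Prod.map (ψ j) (ψ j) p))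
    (ha : Fib S ψ p a) (hb : Fib S ψ p b) (hc : Fib S ψ p c) :
    Fib S ψ p (b3 (sq G) w a b.swap c) := by
  refine ⟨gen2_b3 w ha.1 (gen2_swap hb.1) hc.1, fun j => ?_⟩
  have e : Prod.map (ψ j) (ψ j) b.swap = (Prod.map (ψ j) (ψ j) b).swap := rfl
  rw [(isHom_map (hψ j)).b3, e, ha.2, hb.2, hc.2, (hw j).2.1]

theorem Fib.swap_right (hψ : ∀ j, G.IsHom (S j) (ψ j))
    (hw : ∀ j, IsMaj (S j) w (Prod.map (ψ j) (ψ j) p))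
    (ha : Fib S ψ p a) (hb : Fib S ψ p b) (hc : Fib S ψ p c) :
    Fib S ψ p (b3 (sq G) w a b c.swap) := by
  refine ⟨gen2_b3 w ha.1 hb.1 (gen2_swap hc.1), fun j => ?_⟩
  have e : Prod.map (ψ j) (ψ j) c.swap = (Prod.map (ψ j) (ψ j) c).swap := rfl
  rw [(isHom_map (hψ j)).b3, e, ha.2, hb.2, hc.2, (hw j).1]

theorem w2_of_fib [Finite J] (hG : G.Idempotent) (hψ : ∀ j, G.IsHom (S j) (ψ j))
    (hS : ∀ j, Two (S j) (Prod.map (ψ j) (ψ j) p))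
    (hM : ∀ k z, LR G p k → Fib S ψ p z → ∃ k' w, LR G k k' ∧ b3 (sq G) w k k z = k' ∧
      b3 (sq G) w k z k = k' ∧ b3 (sq G) w z k k = k' ∧
      ∀ j, IsMaj (S j) w (Prod.map (ψ j) (ψ j) p)) : W2 G p := by
  obtain ⟨m, hm⟩ := exists_isMaj S _ hS
  have hp : Fib S ψ p p := Fib.of_LR hψ hS .refl
  obtain ⟨k1, w1, h1, e1, -, -, m1⟩ := hM p _ .refl (hp.swap_right hψ hm hp hp)
  have r0 : R3 (sq G) p p.swap p p p.swap := r3_gen _ _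
  have r1 := R3.b3 w1 r0 r0.swap23 ⟨m, rfl, rfl, rfl⟩
  rw [e1] at r1
  have f2 := hp.swap_mid hψ m1 hp (hp.swap_mid hψ hm hp hp)
  have f3 := hp.swap_left hψ m1 hp (hp.swap_left hψ hm hp hp)
  obtain ⟨k2, w2, h2, e2, e2', -, m2⟩ := hM k1 _ h1 f2
  have r2 := R3.b3 w2 (h1.r3_sq hG (r3_gen _ _)) r1 r1.swap12
  rw [e2, e2'] at r2
  have f4 := (Fib.of_LR hψ hS h1).swap_left hψ m2 f3 f3
  obtain ⟨k3, w3, h3, e3, e3', e3'', -⟩ := hM k2 _ (h1.trans h2) f4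
  have r3 := R3.b3 w3 r2 r2.swap23 r2.rot.rot
  rw [e3, e3', e3''] at r3
  exact ⟨k3, (h1.trans h2).trans h3, r3⟩

end Fiber

/-- Any two distinct elements of `G` are separated by a homomorphism to a factor of `A` mapping
`x` and `y` to elements that generate a subalgebra with at most `n` elements. -/
def Sep (A : UAlgebra σ) (n : ℕ) (G : UAlgebra σ) (x y : G.carrier) : Prop :=
  ∀ u v : G.carrier, u ≠ v → ∃ (B : UAlgebra σ) (φ : G.carrier → B.carrier), IsFactor A B ∧
    G.IsHom B φ ∧ φ u ≠ φ v ∧ size B (φ x) (φ y) ≤ n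

/-- The conclusion of the induction for pairs whose separating factors have size at most `n`. -/
def W2Le (A : UAlgebra σ) (n : ℕ) : Prop :=
  ∀ (G : UAlgebra σ), Finite G.carrier → G.Idempotent → ∀ x y : G.carrier,
    Sep A n G x y → W2 G (x, y)

theorem eq_of_size_le_one [Finite G.carrier] {x y : G.carrier} (h : size G x y ≤ 1) : x = y :=
  (Set.ncard_le_one (Set.toFinite _)).1 h x (Gen2.left _ _) y (Gen2.right _ _)

theorem size_le_two {x y : G.carrier} (h : ∀ z, z = x ∨ z = y) : size G x y ≤ 2 :=
  (Set.ncard_le_ncard (t := {x, y}) (fun z _ => h z) (Set.toFinite _)).trans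
    ((Set.ncard_insert_le x {y}).trans (by rw [Set.ncard_singleton]))

theorem exists_two [Finite A.carrier] (hid : A.Idempotent) (hsm : A.IsSmooth)
    (h1 : A.OmitsType1) (haf : A.AffineFree) {n : ℕ} (hW : W2Le A n) [Finite G.carrier]
    (hG : G.Idempotent) {p : G.carrier × G.carrier} (hmax : LRmax G p)
    (hgen : ∀ z, Gen2 G p.1 p.2 z) {B : UAlgebra σ} {φ : G.carrier → B.carrier}
    (hB : IsFactor A B) (hφ : G.IsHom B φ) {u v : G.carrier} (huv : φ u ≠ φ v)
    (hn : size B (φ p.1) (φ p.2) ≤ n + 1) :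
    ∃ (S : UAlgebra σ) (ψ : G.carrier → S.carrier), G.IsHom S ψ ∧
      (∀ a b, φ a = φ b → ψ a = ψ b) ∧ Two S (Prod.map ψ ψ p) := by
  have := hB.finite
  obtain ⟨κ, hle, hκ⟩ := (ker hφ).exists_isMaximal (fun h => huv (h u v))
  let S := G.quot κ
  let ψ : G.carrier → S.carrier := Quotient.mk κ.toSetoid
  have hψ : G.IsHom S ψ := isHom_quot G κ
  have hsurj : Function.Surjective ψ := Quotient.mk_surjective
  have hker : ∀ a b, φ a = φ b → ψ a = ψ b := fun a b h =>
    Quotient.sound (s := κ.toSetoid) (hle a b h)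
  have hfS : IsFactor A S := hB.of_hom hφ hψ hsurj hker
  have hSf := hfS.finite
  have hSid := hfS.idempotent hid
  have hSs : S.IsSimple := quot_isSimple hκ
  have hgenS : ∀ z, Gen2 S (ψ p.1) (ψ p.2) z := fun z => by
    obtain ⟨g, rfl⟩ := hsurj z
    exact (hgen g).hom hψ
  have hne : ψ p.1 ≠ ψ p.2 := by
    intro e
    refine hκ.1 fun a b => ?_
    have key : ∀ a, ψ a = ψ p.2 := fun a => by
      have := hgenS (ψ a)
      rw [e] at this
      exact gen2_self hSid this
    exact Quotient.exact (s := κ.toSetoid) ((key a).trans (key b).symm)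
  have hcard : Nat.card S.carrier ≤ n + 1 := by
    refine le_trans ?_ ((size_le_of_ker hφ hψ hker p.1 p.2).trans hn)
    exact not_lt.1 fun h => by
      have e : {z | Gen2 S (ψ p.1) (ψ p.2) z} = Set.univ := Set.eq_univ_of_forall hgenS
      rw [size, e, Set.ncard_univ] at h
      exact lt_irrefl _ h
  have hst : Stable S (Prod.map ψ ψ p) := ⟨hne, hgenS, hmax.hom hG hSid hψ⟩
  have hmaj2 : ∀ q : S.carrier × S.carrier, q.1 ≠ q.2 → (∀ z, Gen2 S q.1 q.2 z) →
      R3 (sq S) q q.swap q q q → ∀ z, z = q.1 ∨ z = q.2 := fun q hq hg hr z =>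
    hfS.eq_or_eq_of_majority hsm hid hSs hq hg hr z
  have hgood : Good S := by
    refine ⟨hSf, hSid, hSs, hfS.not_isSetAlgebra h1 hSs hne hgenS,
      hfS.not_isAffineAlgebra haf hSs hne hgenS, hmaj2, fun q z l1 l2 => ?_⟩
    refine hW (sq S) inferInstance (hSid.pr hSid) q z fun a b hab => ?_
    by_cases h : a.1 = b.1
    · exact ⟨S, Prod.snd, hfS, isHom_snd, fun h' => hab (Prod.ext h h'), by omega⟩
    · exact ⟨S, Prod.fst, hfS, isHom_fst, h, by omega⟩
  obtain ⟨c, hc, hr⟩ := (hgood.w2 hst).exact hSid hst.max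
  have hsc := hst.of_LR hSid hc
  have htwo := hmaj2 c hsc.ne hsc.gen hr
  have htwo' : ∀ z, z = ψ p.1 ∨ z = ψ p.2 := by
    intro z
    have hne := hne
    rcases htwo z with rfl | rfl <;> rcases htwo (ψ p.1) with e1 | e1 <;>
      rcases htwo (ψ p.2) with e2 | e2 <;> simp_all
  refine ⟨S, ψ, hψ, hker, hSid, hne, htwo', ?_, ?_⟩
  · rintro ⟨a, b⟩ hz
    rcases htwo' a with rfl | rfl <;> rcases htwo' b with rfl | rfl
    · exact absurd hz (hst.not_t_left hSid)
    · exact Or.inl rfl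
    · exact Or.inr rfl
    · exact absurd hz (hst.not_t_right hSid)
  · obtain ⟨t, hm⟩ := hr
    have hm : IsMaj S t c := hm
    refine ⟨t, ?_⟩
    rcases htwo' c.1 with e1 | e1 <;> rcases htwo' c.2 with e2 | e2
    · exact absurd (e1.trans e2.symm) hsc.ne
    · rwa [show c = Prod.map ψ ψ p from Prod.ext e1 e2] at hm
    · have := hm.swap
      rwa [show c.swap = Prod.map ψ ψ p from Prod.ext e2 e1] at this
    · exact absurd (e1.trans e2.symm) hsc.ne

theorem size_lt_of_ker {B S : UAlgebra σ} [Finite B.carrier] (hS : S.Idempotent)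
    {φ : G.carrier → B.carrier} {ψ : G.carrier → S.carrier} (hφ : G.IsHom B φ)
    (hψ : G.IsHom S ψ) (hk : ∀ u v, φ u = φ v → ψ u = ψ v) {x y : G.carrier}
    (hxy : ψ x ≠ ψ y) (hgen : ∀ z, Gen2 G x y z) {a b : G.carrier} (hab : ψ a = ψ b) :
    size B (φ a) (φ b) < size B (φ x) (φ y) := by
  have key : ∀ z, Gen2 B (φ a) (φ b) (φ z) → ψ z = ψ a := by
    rintro z ⟨t, ht⟩
    rw [← hφ.b2] at ht
    rw [← hk _ _ ht, hψ.b2, ← hab, hS.b2]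
  by_cases h : Gen2 B (φ a) (φ b) (φ x)
  · refine size_lt ((hgen a).hom hφ) ((hgen b).hom hφ) ((hgen y).hom hφ) fun h' => ?_
    exact hxy ((key x h).trans (key y h').symm)
  · exact size_lt ((hgen a).hom hφ) ((hgen b).hom hφ) ((hgen x).hom hφ) h

theorem exists_ascent [Finite A.carrier] {n : ℕ} (hW : W2Le A n)
    [Finite G.carrier] (hG : G.Idempotent) {p : G.carrier × G.carrier} (hmax : LRmax G p)
    {J : Type} [Finite J] {S : J → UAlgebra σ} {ψ : ∀ j, G.carrier → (S j).carrier}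
    (hfS : ∀ j, IsFactor A (S j))
    (hψ : ∀ j, G.IsHom (S j) (ψ j)) (hS : ∀ j, Two (S j) (Prod.map (ψ j) (ψ j) p))
    (hsep : ∀ a b, (∀ j, ψ j a = ψ j b) → ∀ u v : G.carrier, u ≠ v →
      ∃ (B : UAlgebra σ) (φ : G.carrier → B.carrier), IsFactor A B ∧
        G.IsHom B φ ∧ φ u ≠ φ v ∧ size B (φ a) (φ b) ≤ n)
    (k z : G.carrier × G.carrier) (hk : LR G p k) (hz : Fib S ψ p z) :
    ∃ k' w, LR G k k' ∧ b3 (sq G) w k k z = k' ∧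
      b3 (sq G) w k z k = k' ∧ b3 (sq G) w z k k = k' ∧
      ∀ j, IsMaj (S j) w (Prod.map (ψ j) (ψ j) p) := by
  have hkf : Fib S ψ p k := Fib.of_LR hψ hS hk
  have hkz : ∀ j, ψ j k.1 = ψ j z.1 ∧ ψ j k.2 = ψ j z.2 := fun j =>
    Prod.ext_iff.1 ((hkf.2 j).trans (hz.2 j).symm)
  have hs1 := hsep k.1 z.1 fun j => (hkz j).1
  have hs2 := hsep k.2 z.2 fun j => (hkz j).2
  rcases Nat.lt_or_ge n 2 with hn | hn
  · have hkz' : z = k := by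
      by_contra hne
      have key : ∀ a b : G.carrier, (∀ u v : G.carrier, u ≠ v →
          ∃ (B : UAlgebra σ) (φ : G.carrier → B.carrier), IsFactor A B ∧
          G.IsHom B φ ∧ φ u ≠ φ v ∧ size B (φ a) (φ b) ≤ n) → a = b := by
        intro a b h
        by_contra hab
        obtain ⟨B, φ, hB, -, hne, hle⟩ := h a b hab
        have := hB.finite
        exact hne (eq_of_size_le_one (by omega))
      exact hne (Prod.ext (key _ _ hs1).symm (key _ _ hs2).symm)
    obtain ⟨m, hm⟩ := exists_isMaj S _ hS
    subst hkz'
    exact ⟨z, m, .refl, (hG.pr hG).b3 _ _, (hG.pr hG).b3 _ _, (hG.pr hG).b3 _ _, hm⟩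
  · have hSf := fun j => (hfS j).finite
    have hpi : (pi S).Idempotent := fun f x => funext fun j => (hS j).idem f (x j)
    have hfin : Finite (pi S).carrier := Pi.finite
    have hw := hW (pr (sq G) (pi S)) (@Finite.instProd _ _ inferInstance hfin) ((hG.pr hG).pr hpi)
      (k, fun j => ψ j p.1) (z, fun j => ψ j p.2) (by
        intro u v huv
        by_cases h1 : u.1.1 = v.1.1
        · by_cases h2 : u.1.2 = v.1.2
          · have h3 : u.2 ≠ v.2 := fun h3 => huv (Prod.ext (Prod.ext h1 h2) h3)
            obtain ⟨j, hj⟩ := Function.ne_iff.1 h3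
            exact ⟨S j, fun x => x.2 j, hfS j, fun _ _ => rfl, hj,
              (size_le_two (hS j).two).trans hn⟩
          · obtain ⟨B, φ, hB, hφ, hne, hle⟩ := hs2 _ _ h2
            exact ⟨B, fun x => φ x.1.2, hB, fun f _ => hφ f _, hne, hle⟩
        · obtain ⟨B, φ, hB, hφ, hne, hle⟩ := hs1 _ _ h1
          exact ⟨B, fun x => φ x.1.1, hB, fun f _ => hφ f _, hne, hle⟩)
    obtain ⟨x', y', w, hLR, e1, e2, e3, e4, e5, e6⟩ := hw.exists_term
    have hT : T G k z.1 z.2 := (hmax k hk).t hz.1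
    have hLR1 := LR.hom (isHom_fst (A := sq G) (B := pi S)) hLR
    have f := fun {a b c d} (e : b3 (pr (sq G) (pi S)) w a b c = d) =>
      ((isHom_fst (A := sq G) (B := pi S)).b3 w a b c).symm.trans (congrArg Prod.fst e)
    refine ⟨x'.1, w, (lr_of_sq (hmax.of_LR hk) hT hLR1).1, f e1, f e2, f e3, fun j => ?_⟩
    have hj : (pr (sq G) (pi S)).IsHom (S j) fun x => x.2 j := fun _ _ => rfl
    obtain ⟨hx, hy⟩ := Prod.ext_iff.1 ((hS j).eq_of_LR (hLR.hom hj))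
    have g := fun {a b c d} (e : b3 (pr (sq G) (pi S)) w a b c = d) =>
      (hj.b3 w a b c).symm.trans (congrArg (fun x => x.2 j) e)
    rw [IsMaj, b3_pr, b3_pr, b3_pr]
    exact ⟨Prod.ext ((g e1).trans hx) ((g e4).trans hy),
      Prod.ext ((g e2).trans hx) ((g e5).trans hy), Prod.ext ((g e3).trans hx) ((g e6).trans hy)⟩

theorem W2Le.succ [Finite A.carrier] (hid : A.Idempotent) (hsm : A.IsSmooth)
    (h1 : A.OmitsType1) (haf : A.AffineFree) {n : ℕ} (hW : W2Le A n) : W2Le A (n + 1) := by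
  suffices key : ∀ (G : UAlgebra σ), Finite G.carrier → G.Idempotent →
      ∀ p : G.carrier × G.carrier, LRmax G p → (∀ z, Gen2 G p.1 p.2 z) →
      Sep A (n + 1) G p.1 p.2 → W2 G p by
    intro G hfin hG x y hsep
    obtain ⟨p, hp, hmax⟩ := exists_LRmax (A := G) (x, y)
    refine W2.of_LR hG hp ?_
    have hD := gen2_isClosed (A := G) p.1 p.2
    let H := G.subalg _ hD
    have hι : H.IsHom G Subtype.val := isHom_subtype hD
    let q : H.carrier × H.carrier := (⟨p.1, Gen2.left _ _⟩, ⟨p.2, Gen2.right _ _⟩)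
    have hq := key H (inferInstanceAs (Finite {z // Gen2 G p.1 p.2 z}))
      (fun f a => Subtype.ext (hG f a.1)) q
      (LRmax.of_inj hι Subtype.val_injective hmax) ?_ ?_
    · exact hq.hom hι
    · rintro ⟨z, s, hs⟩
      exact ⟨s, Subtype.ext ((hι.b2 s q.1 q.2).trans hs)⟩
    · intro u v huv
      obtain ⟨B, φ, hB, hφ, hne, hle⟩ := hsep u.1 v.1 fun h => huv (Subtype.ext h)
      have := hB.finite
      refine ⟨B, φ ∘ Subtype.val, hB, hφ.comp hι, hne, (size_le ?_ ?_).trans hle⟩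
      · exact (hp.gen (Gen2.left _ _)).hom hφ
      · exact (hp.gen (Gen2.right _ _)).hom hφ
  intro G hfin hG p hmax hgen hsep
  let J := {q : G.carrier × G.carrier // q.1 ≠ q.2 ∧
    ¬ ∃ (B : UAlgebra σ) (φ : G.carrier → B.carrier), IsFactor A B ∧
      G.IsHom B φ ∧ φ q.1 ≠ φ q.2 ∧ size B (φ p.1) (φ p.2) ≤ n}
  choose B φ hB hφ hne hle using fun j : J => hsep j.1.1 j.1.2 j.2.1
  choose S ψ hψ hker hS using fun j : J =>
    exists_two hid hsm h1 haf hW hG hmax hgen (hB j) (hφ j) (hne j) (hle j)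
  have hfS : ∀ j, IsFactor A (S j) := fun j => by
    refine (hB j).of_hom (hφ j) (hψ j) (fun z => ?_) (hker j)
    rcases (hS j).two z with e | e
    · exact ⟨p.1, e.symm⟩
    · exact ⟨p.2, e.symm⟩
  refine w2_of_fib hG hψ hS (exists_ascent hW hG hmax hfS hψ hS fun a b hab u v huv => ?_)
  by_cases h : ∃ (B : UAlgebra σ) (φ : G.carrier → B.carrier), IsFactor A B ∧
      G.IsHom B φ ∧ φ u ≠ φ v ∧ size B (φ p.1) (φ p.2) ≤ n
  · obtain ⟨B, φ, hB, hφ, hne, hle⟩ := h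
    have := hB.finite
    exact ⟨B, φ, hB, hφ, hne, (size_le ((hgen a).hom hφ) ((hgen b).hom hφ)).trans hle⟩
  · let j : J := ⟨(u, v), huv, h⟩
    have := (hB j).finite
    have hlt := size_lt_of_ker (hS j).idem (hφ j) (hψ j) (hker j) (hS j).ne hgen (hab j)
    have := hle j
    exact ⟨B j, φ j, hB j, hφ j, hne j, by omega⟩

theorem w2Le [Finite A.carrier] (hid : A.Idempotent) (hsm : A.IsSmooth)
    (h1 : A.OmitsType1) (haf : A.AffineFree) (n : ℕ) : W2Le A n := by
  induction n with
  | zero =>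
    intro G _ hG x y hsep
    have hxy : x = y := by
      by_contra hne
      obtain ⟨B, φ, hB, -, hne, hle⟩ := hsep x y hne
      have := hB.finite
      exact hne (eq_of_size_le_one (by omega))
    subst hxy
    exact ⟨(x, x), .refl, r3_gen _ _⟩
  | succ n ih => exact ih.succ hid hsm h1 haf

end UAlgebra

end Subdirect

/-- in a smooth affine free finite idempotent algebra omitting
type 1, any two maximal elements are connected by a path through maximal
elements consisting of thin semilattice edges and undirected thin majority
edges, with at most one majority edge. -/
theorem stmt_18 (σ : Signature) (A : UAlgebra σ)
    (hfin : Finite A.carrier) (hne : Nonempty A.carrier) (hid : A.Idempotent)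
    (hsm : A.IsSmooth) (h1 : A.OmitsType1) (haf : A.AffineFree)
    (a b : A.carrier) (ha : A.IsMaxElem a) (hb : A.IsMaxElem b) :
    ∃ (k : ℕ) (c : ℕ → A.carrier), c 0 = a ∧ c k = b ∧
      (∀ i ≤ k, A.IsMaxElem (c i)) ∧
      (∀ i < k, A.IsThinSLEdge (c i) (c (i + 1)) ∨
        A.IsUndirThinMajEdge (c i) (c (i + 1))) ∧
      (∀ i < k, ∀ j < k, ¬ A.IsThinSLEdge (c i) (c (i + 1)) →
        ¬ A.IsThinSLEdge (c j) (c (j + 1)) → i = j) := by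
  refine UAlgebra.exists_path_of_W2 hid ha hb fun p => ?_
  exact UAlgebra.w2Le hid hsm h1 haf (UAlgebra.size A p.1 p.2) A hfin hid p.1 p.2
    fun u v huv => ⟨A, id, UAlgebra.isFactor_refl A, fun _ _ => rfl, huv, le_rfl⟩
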